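/- Let C₁ be an irreducible component of C with deg C₁ = d₁ ≥ 2, let l₀ ∈ T_C be a line meeting C transversally, and let P₁, P₂ be two distinct points of C₁ ∩ l₀. Then there exist a loop γ : [0,1] → T_C with γ(0) = γ(1) = l₀ and, for each point P ∈ C ∩ l₀, a continuous map ψ_P : [0,1] → ℙ² with ψ_P(0) = P and ψ_P(t) ∈ C ∩ γ(t) for all t, such that for every t ∈ [0,1] the points ψ_P(t), P ∈ C ∩ l₀, are pairwise distinct, and at time t = 1 one has ψ_{P₁}(1) = P₂, ψ_{P₂}(1) = P₁, and ψ_P(1) = P for every P ∈ (C ∩ l₀) \ {P₁, P₂}. In other words, the monodromy along γ is the transposition of P₁ and P₂ and the identity on the remaining points of C ∩ l₀. -/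

import Mathlib

open MvPolynomial

noncomputable section

/-- The complex projective plane `ℙ²(ℂ)` (also used as its own dual `ℙ̂²`). -/
abbrev P2 : Type := Projectivization ℂ (Fin 3 → ℂ)

/-- The classical (Euclidean) topology on `ℙ²(ℂ)`: the quotient topology from
`ℂ³ \ {0}`. -/
instance : TopologicalSpace P2 :=
  inferInstanceAs (TopologicalSpace (Quotient (projectivizationSetoid ℂ (Fin 3 → ℂ))))

/-- The line in `ℙ²` corresponding to a point `ξ` of the dual plane `ℙ̂²`:
the zero locus of the linear form with coefficient vector `ξ`. -/
def lineSet (ξ : P2) : Set P2 := {x | ∑ i, ξ.rep i * x.rep i = 0}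

/-- The plane curve `{F = 0} ⊂ ℙ²` defined by a homogeneous polynomial `F`. -/
def curveSet (F : MvPolynomial (Fin 3) ℂ) : Set P2 := {x | eval x.rep F = 0}

/-- `T_C`: the set of (points of `ℙ̂²` corresponding to) lines meeting the degree `d`
curve `C = {F = 0}` transversally, i.e. in exactly `d` distinct points. -/
def transversalLines (F : MvPolynomial (Fin 3) ℂ) (d : ℕ) : Set P2 :=
  {ξ | (curveSet F ∩ lineSet ξ).ncard = d}

namespace PlaneCurve

open scoped Polynomial Topology

section Separability

lemma exists_separability_witness {R : Type*} [CommRing R] (p : R[X]) (d : ℕ) (hd : 1 ≤ d)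
    (hp : p.natDegree ≤ d) :
    ∃ δ : R, ∀ φ : R →+* ℂ,
      φ δ ≠ 0 ↔ (p.map φ).natDegree = d ∧ (p.map φ).Separable := by
  refine ⟨p.coeff d * p.resultant (Polynomial.derivative p) d (d - 1), fun φ => ?_⟩
  have hmap : φ (p.resultant (Polynomial.derivative p) d (d - 1)) =
      (p.map φ).resultant (Polynomial.derivative (p.map φ)) d (d - 1) := by
    rw [Polynomial.derivative_map, Polynomial.resultant_map_map]
  have hle : (p.map φ).natDegree ≤ d := Polynomial.natDegree_map_le.trans hp
  rw [map_mul, mul_ne_zero_iff, hmap, ← Polynomial.coeff_map]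
  have key : (p.map φ).natDegree = d →
      ((p.map φ).resultant (Polynomial.derivative (p.map φ)) d (d - 1) ≠ 0 ↔
        (p.map φ).Separable) := by
    intro h
    have h2 : (Polynomial.derivative (p.map φ)).natDegree = d - 1 := by
      rw [Polynomial.natDegree_derivative, h]
    have := Polynomial.resultant_eq_zero_iff (f := p.map φ)
      (g := Polynomial.derivative (p.map φ))
    rw [h, h2] at this
    rw [Ne, this, Polynomial.Separable]
    have hne : p.map φ ≠ 0 := by
      intro h0
      rw [h0] at h
      simp at h
      omega
    simp [hne]
  constructor
  · rintro ⟨h1, h2⟩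
    have : (p.map φ).natDegree = d :=
      le_antisymm hle (Polynomial.le_natDegree_of_ne_zero h1)
    exact ⟨this, (key this).1 h2⟩
  · rintro ⟨h1, h2⟩
    refine ⟨?_, (key h1).2 h2⟩
    rw [← h1]
    intro h0
    rw [Polynomial.coeff_natDegree, Polynomial.leadingCoeff_eq_zero] at h0
    rw [h0] at h1
    simp at h1
    omega

lemma exists_injective_roots {p : ℂ[X]} {d : ℕ} (hd : p.natDegree = d) (hs : p.Separable) :
    ∃ x : Fin d → ℂ, Function.Injective x ∧ ∀ i, p.eval (x i) = 0 := by
  have hcard : p.roots.toFinset.card = d := by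
    rw [Multiset.toFinset_card_of_nodup (Polynomial.nodup_roots hs), ← hd]
    exact (IsAlgClosed.splits p).natDegree_eq_card_roots.symm
  let e := p.roots.toFinset.equivFinOfCardEq hcard
  refine ⟨fun i => (e.symm i : ℂ), fun i j h => e.symm.injective (Subtype.ext h), fun i => ?_⟩
  have := (e.symm i).2
  rw [Multiset.mem_toFinset] at this
  exact (Polynomial.mem_roots'.1 this).2

lemma natDegree_le_card_of_roots {p : ℂ[X]} {d : ℕ} (hp : p ≠ 0) {x : Fin d → ℂ}
    (hx : Function.Injective x) (hr : ∀ i, p.eval (x i) = 0) :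
    d ≤ p.natDegree := by
  have : (Finset.univ.image x).card ≤ p.natDegree := by
    refine Polynomial.card_le_degree_of_subset_roots ?_
    intro z hz
    obtain ⟨i, -, rfl⟩ := Finset.mem_image.1 (show z ∈ Finset.univ.image x from hz)
    exact (Polynomial.mem_roots hp).2 (hr i)
  rwa [Finset.card_image_of_injective _ hx, Finset.card_univ, Fintype.card_fin] at this

lemma exists_eq_of_root {p : ℂ[X]} {d : ℕ} (hp : p ≠ 0) (hd : p.natDegree ≤ d) {x : Fin d → ℂ}
    (hx : Function.Injective x) (hr : ∀ i, p.eval (x i) = 0) {z : ℂ} (hz : p.eval z = 0) :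
    ∃ i, x i = z := by
  have hsub : Finset.univ.image x ⊆ p.roots.toFinset := by
    intro z hz
    obtain ⟨i, -, rfl⟩ := Finset.mem_image.1 hz
    simpa [hp] using hr i
  have hc : p.roots.toFinset.card ≤ (Finset.univ.image x).card := by
    rw [Finset.card_image_of_injective _ hx, Finset.card_univ, Fintype.card_fin]
    exact (Multiset.toFinset_card_le _).trans ((Polynomial.card_roots' p).trans hd)
  have hmem : z ∈ Finset.univ.image x := by
    rw [Finset.eq_of_subset_of_card_le hsub hc]
    simpa [hp] using hz
  simpa using hmem

lemma derivative_eval_ne_zero {p : ℂ[X]} {d : ℕ} (hp : p ≠ 0) (hd : p.natDegree ≤ d)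
    {x : Fin d → ℂ} (hx : Function.Injective x) (hr : ∀ i, p.eval (x i) = 0) (i : Fin d) :
    p.derivative.eval (x i) ≠ 0 := by
  intro h0
  have h1 : 1 < p.rootMultiplicity (x i) :=
    (Polynomial.one_lt_rootMultiplicity_iff_isRoot hp).2 ⟨hr i, h0⟩
  have hsub : Finset.univ.image x ⊆ p.roots.toFinset := by
    intro z hz
    obtain ⟨i, -, rfl⟩ := Finset.mem_image.1 hz
    simpa [hp] using hr i
  have h2 : ∑ z ∈ Finset.univ.image x, p.roots.count z ≤ d := by
    calc _ ≤ ∑ z ∈ p.roots.toFinset, p.roots.count z :=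
          Finset.sum_le_sum_of_subset hsub
      _ = p.roots.card := Multiset.toFinset_sum_count_eq _
      _ ≤ d := (Polynomial.card_roots' p).trans hd
  rw [Finset.sum_image (fun a _ b _ h => hx h)] at h2
  have h3 : ∑ j : Fin d, 1 < ∑ j : Fin d, p.roots.count (x j) := by
    refine Finset.sum_lt_sum (fun j _ => ?_) ⟨i, Finset.mem_univ i, ?_⟩
    · rw [Polynomial.count_roots]
      exact (Polynomial.rootMultiplicity_pos hp).2 (hr j)
    · rwa [Polynomial.count_roots]
  rw [Finset.sum_const, Finset.card_univ, Fintype.card_fin, smul_eq_mul, mul_one] at h3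
  omega

lemma separable_of_injective_roots {p : ℂ[X]} {d : ℕ} (hp : p ≠ 0) (hd : p.natDegree ≤ d)
    {x : Fin d → ℂ} (hx : Function.Injective x) (hr : ∀ i, p.eval (x i) = 0) :
    p.Separable := by
  refine (Polynomial.isCoprime_iff_aeval_ne_zero_of_isAlgClosed ℂ ℂ _ _).2 fun z => ?_
  by_contra! h
  simp only [Polynomial.coe_aeval_eq_eval] at h
  obtain ⟨i, rfl⟩ := exists_eq_of_root hp hd hx hr h.1
  exact derivative_eval_ne_zero hp hd hx hr i h.2

lemma separable_derivative_eval_ne_zero {p : ℂ[X]} (hs : p.Separable) {z : ℂ} (hz : p.eval z = 0) :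
    p.derivative.eval z ≠ 0 := by
  have := (Polynomial.isCoprime_iff_aeval_ne_zero_of_isAlgClosed ℂ ℂ _ _).1 hs z
  simpa [hz] using this

end Separability

section Families

variable {E : Type*} [NormedAddCommGroup E] [NormedSpace ℂ E] [CompleteSpace E]

lemma exists_implicit_function {Φ : E × ℂ → ℂ} (hΦ : ContDiff ℂ 1 Φ) {e₀ : E} {z₀ c : ℂ}
    (h0 : Φ (e₀, z₀) = 0) (hd : HasDerivAt (fun z => Φ (e₀, z)) c z₀) (hc : c ≠ 0) :
    ∃ σ : E → ℂ, σ e₀ = z₀ ∧ ContDiffAt ℂ 1 σ e₀ ∧ (∀ᶠ e in 𝓝 e₀, Φ (e, σ e) = 0) ∧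
      ∀ᶠ v in 𝓝 (e₀, z₀), Φ v = 0 → σ v.1 = v.2 := by
  have cdf : ContDiffAt ℂ 1 Φ (e₀, z₀) := hΦ.contDiffAt
  have hval : (fderiv ℂ Φ (e₀, z₀) ∘L .inr ℂ E ℂ) 1 = c := by
    have h1 : HasFDerivAt Φ (fderiv ℂ Φ (e₀, z₀)) (e₀, z₀) :=
      (hΦ.differentiable one_ne_zero _).hasFDerivAt
    have h2 : HasDerivAt (fun z : ℂ => (e₀, z)) ((0 : E), (1 : ℂ)) z₀ :=
      (hasDerivAt_const z₀ e₀).prodMk (hasDerivAt_id z₀)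
    have h3 := h1.comp_hasDerivAt z₀ h2
    simpa using h3.unique hd
  have hinv : (fderiv ℂ Φ (e₀, z₀) ∘L .inr ℂ E ℂ).IsInvertible := by
    refine ⟨ContinuousLinearEquiv.unitsEquivAut ℂ (Units.mk0 c hc), ?_⟩
    ext
    simp [← hval]
  refine ⟨cdf.implicitFunction one_ne_zero hinv, cdf.implicitFunction_apply_self one_ne_zero hinv,
    cdf.contDiffAt_implicitFunction one_ne_zero hinv, ?_, ?_⟩
  · simpa [h0] using cdf.eventually_apply_implicitFunction one_ne_zero hinv
  · filter_upwards [cdf.eventually_apply_eq_iff_implicitFunction one_ne_zero hinv] with v hv h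
    exact hv.1 (h.trans h0.symm)

/-- The pairs consisting of a parameter `e` and `d` distinct labelled roots of `p e`. -/
def rootConfigurations (p : E → ℂ[X]) (d : ℕ) : Set (E × (Fin d → ℂ)) :=
  {v | p v.1 ≠ 0 ∧ Function.Injective v.2 ∧ ∀ i, (p v.1).eval (v.2 i) = 0}

lemma exists_local_sections {p : E → ℂ[X]} (hp : ContDiff ℂ 1 fun v : E × ℂ => (p v.1).eval v.2)
    {d : ℕ} (hdeg : ∀ e, (p e).natDegree ≤ d) {e₀ : E} {x : Fin d → ℂ}
    (hx : (e₀, x) ∈ rootConfigurations p d) :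
    ∃ σ : Fin d → E → ℂ, (∀ i, σ i e₀ = x i) ∧ (∀ i, ContDiffAt ℂ 1 (σ i) e₀) ∧
      ∀ᶠ e in 𝓝 e₀, (∀ i, ContinuousAt (σ i) e) ∧
        (e, fun i => σ i e) ∈ rootConfigurations p d := by
  obtain ⟨h0, hinj, hr⟩ := hx
  have H : ∀ i, ∃ σ : E → ℂ, σ e₀ = x i ∧ ContDiffAt ℂ 1 σ e₀ ∧
      (∀ᶠ e in 𝓝 e₀, (p e).eval (σ e) = 0) := by
    intro i
    obtain ⟨σ, h1, h2, h3, -⟩ := exists_implicit_function hp (hr i)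
      ((p e₀).hasDerivAt (x i)) (derivative_eval_ne_zero h0 (hdeg e₀) hinj hr i)
    exact ⟨σ, h1, h2, h3⟩
  choose σ h1 h2 h3 using H
  refine ⟨σ, h1, h2, ?_⟩
  have hne : ∀ᶠ e in 𝓝 e₀, p e ≠ 0 := by
    obtain ⟨z, hz⟩ : ∃ z, (p e₀).eval z ≠ 0 := by
      by_contra! h
      exact h0 (Polynomial.funext fun z => by simpa using h z)
    have hcont : Continuous fun e => (p e).eval z :=
      hp.continuous.comp (Continuous.prodMk continuous_id continuous_const)
    filter_upwards [hcont.continuousAt.eventually_ne hz] with e he h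
    simp [h] at he
  have hinj' : ∀ᶠ e in 𝓝 e₀, ∀ i j, i ≠ j → σ i e ≠ σ j e := by
    rw [Filter.eventually_all]
    intro i
    rw [Filter.eventually_all]
    intro j
    by_cases hij : i = j
    · simp [hij]
    have : σ i e₀ - σ j e₀ ≠ 0 := by
      rw [h1, h1]
      exact sub_ne_zero.2 fun h => hij (hinj h)
    filter_upwards [((h2 i).continuousAt.sub (h2 j).continuousAt).eventually_ne this] with e he _
    exact sub_ne_zero.1 he
  have hcd : ∀ᶠ e in 𝓝 e₀, ∀ i, ContinuousAt (σ i) e := by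
    rw [Filter.eventually_all]
    intro i
    filter_upwards [(h2 i).eventually (by simp)] with e he using he.continuousAt
  filter_upwards [hne, hinj', hcd, Filter.eventually_all.2 h3] with e a1 a2 a3 a4
  exact ⟨a3, a1, fun i j h => by_contra fun hij => a2 i j hij h, a4⟩

/-- Near a parameter with a full set of `d` distinct roots, labelled roots can be transported
uniquely and continuously. -/
lemma exists_ball_sections {p : E → ℂ[X]} (hp : ContDiff ℂ 1 fun v : E × ℂ => (p v.1).eval v.2)
    {d : ℕ} (hdeg : ∀ e, (p e).natDegree ≤ d) {e₀ : E} {x : Fin d → ℂ}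
    (hx : (e₀, x) ∈ rootConfigurations p d) :
    ∃ σ : Fin d → E → ℂ, (∀ i, σ i e₀ = x i) ∧ (∀ i, ContDiffAt ℂ 1 (σ i) e₀) ∧
      ∃ r > 0, (∀ i, ContinuousOn (σ i) (Metric.ball e₀ r)) ∧
        ∀ e ∈ Metric.ball e₀ r, (e, fun i => σ i e) ∈ rootConfigurations p d := by
  obtain ⟨σ, h1, h2, h3⟩ := exists_local_sections hp hdeg hx
  obtain ⟨r, hr, h⟩ := Metric.eventually_nhds_iff_ball.1 h3
  exact ⟨σ, h1, h2, r, hr, fun i e he => ((h e he).1 i).continuousWithinAt, fun e he => (h e he).2⟩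

end Families

section Growth

/-- A real function on `ℂ` bounded above by a function of polynomial growth. -/
def PolynomialGrowth (u : ℂ → ℝ) : Prop :=
  ∃ C : ℝ, 0 ≤ C ∧ ∃ N : ℕ, ∀ x, u x ≤ C * (1 + ‖x‖) ^ N

lemma PolynomialGrowth.const (c : ℝ) : PolynomialGrowth fun _ => c :=
  ⟨|c|, abs_nonneg c, 0, fun x => by simpa using le_abs_self c⟩

lemma PolynomialGrowth.add {u v : ℂ → ℝ} (hu : PolynomialGrowth u) (hv : PolynomialGrowth v) :
    PolynomialGrowth fun x => u x + v x := by
  obtain ⟨C, hC, N, h⟩ := hu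
  obtain ⟨D, hD, M, k⟩ := hv
  refine ⟨C + D, by positivity, N + M, fun x => ?_⟩
  have h1 : (1 : ℝ) ≤ 1 + ‖x‖ := by simp
  have h2 : (1 + ‖x‖) ^ N ≤ (1 + ‖x‖) ^ (N + M) := pow_le_pow_right₀ h1 (by omega)
  have h3 : (1 + ‖x‖) ^ M ≤ (1 + ‖x‖) ^ (N + M) := pow_le_pow_right₀ h1 (by omega)
  calc u x + v x ≤ C * (1 + ‖x‖) ^ N + D * (1 + ‖x‖) ^ M := add_le_add (h x) (k x)
    _ ≤ C * (1 + ‖x‖) ^ (N + M) + D * (1 + ‖x‖) ^ (N + M) := by gcongr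
    _ = _ := by ring

lemma PolynomialGrowth.mul {u v : ℂ → ℝ} (hu : PolynomialGrowth u) (hv : PolynomialGrowth v)
    (hv0 : ∀ x, 0 ≤ v x) : PolynomialGrowth fun x => u x * v x := by
  obtain ⟨C, hC, N, h⟩ := hu
  obtain ⟨D, hD, M, k⟩ := hv
  refine ⟨C * D, by positivity, N + M, fun x => ?_⟩
  calc u x * v x ≤ (C * (1 + ‖x‖) ^ N) * (D * (1 + ‖x‖) ^ M) :=
        mul_le_mul (h x) (k x) (hv0 x) (by positivity)
    _ = _ := by ring

lemma PolynomialGrowth.pow {u : ℂ → ℝ} (hu : PolynomialGrowth u) (hu0 : ∀ x, 0 ≤ u x) (n : ℕ) :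
    PolynomialGrowth fun x => u x ^ n := by
  induction n with
  | zero => simpa using PolynomialGrowth.const 1
  | succ n ih => simpa only [pow_succ] using ih.mul hu hu0

lemma PolynomialGrowth.sum {ι : Type*} (s : Finset ι) {u : ι → ℂ → ℝ}
    (hu : ∀ i, PolynomialGrowth (u i)) : PolynomialGrowth fun x => ∑ i ∈ s, u i x := by
  classical
  induction s using Finset.induction_on with
  | empty => simpa using PolynomialGrowth.const 0
  | insert a s ha ih => simpa only [Finset.sum_insert ha] using (hu a).add ih

lemma PolynomialGrowth.norm_eval (q : ℂ[X]) : PolynomialGrowth fun x => ‖q.eval x‖ := by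
  obtain ⟨C, hC, N, h⟩ : PolynomialGrowth fun x =>
      ∑ i ∈ Finset.range (q.natDegree + 1), ‖q.coeff i‖ * ‖x‖ ^ i := by
    refine PolynomialGrowth.sum _ fun i => (PolynomialGrowth.const _).mul
      (PolynomialGrowth.pow ⟨1, zero_le_one, 1, fun x => by simp⟩ (fun x => norm_nonneg x) i)
      fun x => by positivity
  refine ⟨C, hC, N, fun x => le_trans ?_ (h x)⟩
  beta_reduce
  rw [Polynomial.eval_eq_sum_range]
  exact (norm_sum_le _ _).trans (by simp)

end Growth

section Extension

open Complex Filter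

lemma exists_entire_extension (S : Finset ℂ) : ∀ e : ℂ → ℂ, (∀ x ∉ S, DifferentiableAt ℂ e x) →
    (∀ c, ∃ B : ℝ, ∀ᶠ x in 𝓝 c, x ∉ S → ‖e x‖ ≤ B) →
    ∃ g : ℂ → ℂ, Differentiable ℂ g ∧ ∀ x ∉ S, g x = e x := by
  induction S using Finset.induction_on with
  | empty => exact fun e hd _ => ⟨e, fun x => hd x (by simp), fun x _ => rfl⟩
  | insert c S hc ih =>
    intro e hd hb
    set L := limUnder (𝓝[≠] c) e with hL
    have hS : ∀ᶠ x in 𝓝 c, x ∉ S :=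
      (S.finite_toSet.isClosed.isOpen_compl).mem_nhds (by simpa using hc)
    have hdc : DifferentiableAt ℂ (Function.update e c L) c := by
      obtain ⟨B, hB⟩ := hb c
      obtain ⟨r, hr, h⟩ := Metric.eventually_nhds_iff_ball.1 (hB.and hS)
      have := differentiableOn_update_limUnder_of_bddAbove (f := e) (c := c)
        (Metric.ball_mem_nhds c hr)
        (fun x hx => (hd x (by
          have := (h x hx.1).2
          simp only [Finset.mem_insert, not_or]
          exact ⟨hx.2, this⟩)).differentiableWithinAt)
        ⟨B, by
          rintro _ ⟨x, hx, rfl⟩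
          refine (h x hx.1).1 ?_
          have := (h x hx.1).2
          simp only [Finset.mem_insert, not_or]
          exact ⟨hx.2, this⟩⟩
      exact this.differentiableAt (Metric.ball_mem_nhds c hr)
    obtain ⟨g, hg, hge⟩ := ih (Function.update e c L) (by
      intro x hx
      by_cases hxc : x = c
      · rwa [hxc]
      · refine (hd x (by simp [hxc, hx])).congr_of_eventuallyEq ?_
        filter_upwards [isOpen_ne.mem_nhds hxc] with y hy
        exact Function.update_of_ne hy _ _) (by
      intro a
      obtain ⟨B, hB⟩ := hb a
      refine ⟨max B ‖L‖, ?_⟩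
      filter_upwards [hB] with x hx hxS
      by_cases hxc : x = c
      · simp [hxc]
      · rw [Function.update_of_ne hxc]
        exact (hx (by simp [hxc, hxS])).trans (le_max_left _ _))
    refine ⟨g, hg, fun x hx => ?_⟩
    simp only [Finset.mem_insert, not_or] at hx
    rw [hge x hx.2, Function.update_of_ne hx.1]

lemma exists_polynomial_of_growth (S : Finset ℂ) {e : ℂ → ℂ}
    (hd : ∀ x ∉ S, DifferentiableAt ℂ e x) {u : ℂ → ℝ} (hu : PolynomialGrowth u)
    (hb : ∀ x ∉ S, ‖e x‖ ≤ u x) : ∃ q : ℂ[X], ∀ x ∉ S, q.eval x = e x := by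
  obtain ⟨C, hC, N, hu⟩ := hu
  obtain ⟨g, hg, hge⟩ := exists_entire_extension S e hd (by
    intro c
    refine ⟨C * (1 + ‖c‖) ^ N + 1, ?_⟩
    have hcont : ContinuousAt (fun x : ℂ => C * (1 + ‖x‖) ^ N) c := by fun_prop
    filter_upwards [hcont.eventually (gt_mem_nhds (lt_add_one _))] with x hx hxS
    exact (hb x hxS).trans ((hu x).trans hx.le))
  obtain ⟨R₀, hR₀⟩ : ∃ R₀ : ℝ, ∀ x ∈ S, ‖x‖ < R₀ := by
    obtain ⟨r, hr⟩ := (S.finite_toSet.isBounded).exists_norm_le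
    exact ⟨r + 1, fun x hx => (hr x hx).trans_lt (lt_add_one r)⟩
  have hzero : ∀ n, N < n → iteratedDeriv n g 0 = 0 := by
    intro n hn
    have hlim : Tendsto (fun R : ℝ => (n.factorial * (C * 2 ^ N)) / R) atTop (𝓝 0) :=
      tendsto_const_nhds.div_atTop tendsto_id
    have hle : ∀ᶠ R : ℝ in atTop, ‖iteratedDeriv n g 0‖ ≤ (n.factorial * (C * 2 ^ N)) / R := by
      filter_upwards [eventually_ge_atTop (max R₀ 1)] with R hR
      have hR1 : 1 ≤ R := (le_max_right _ _).trans hR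
      have hR0 : 0 < R := by linarith
      have h1 := norm_iteratedDeriv_le_of_forall_mem_sphere_norm_le (c := (0 : ℂ)) n hR0
        (hg.diffContOnCl) (C := C * (2 * R) ^ N) (fun z hz => by
          have hz' : ‖z‖ = R := by simpa using hz
          have hzS : z ∉ S := fun h => by
            have := hR₀ z h
            have := (le_max_left _ _).trans hR
            linarith
          rw [hge z hzS]
          refine (hb z hzS).trans ((hu z).trans ?_)
          rw [hz']
          gcongr
          linarith)
      refine h1.trans ?_
      obtain ⟨k, rfl⟩ := Nat.exists_eq_add_of_lt hn
      rw [div_le_div_iff₀ (by positivity) hR0]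
      have : R ^ N * R ≤ R ^ (N + k + 1) := by
        rw [← pow_succ]
        exact pow_le_pow_right₀ hR1 (by omega)
      calc _ = ((N + k + 1).factorial * (C * 2 ^ N)) * (R ^ N * R) := by
            rw [mul_pow]; ring
        _ ≤ _ := by gcongr
    have := ge_of_tendsto hlim hle
    simpa using this
  refine ⟨∑ n ∈ Finset.range (N + 1), Polynomial.monomial n ((n.factorial : ℂ)⁻¹ *
    iteratedDeriv n g 0), fun x hx => ?_⟩
  rw [← hge x hx, ← taylorSeries_eq_of_entire' 0 x hg, tsum_eq_sum (s := Finset.range (N + 1))]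
  · simp [Polynomial.eval_finsetSum]
  · intro n hn
    rw [hzero n (by simpa using hn)]
    simp

end Extension

section Bivariate

lemma contDiff_evalEval (f : ℂ[X][X]) {n : WithTop ℕ∞} :
    ContDiff ℂ n fun v : ℂ × ℂ => f.evalEval v.1 v.2 := by
  induction f using Polynomial.induction_on' with
  | add p q hp hq => simpa only [Polynomial.evalEval_add] using hp.add hq
  | monomial k a =>
    have : (fun v : ℂ × ℂ => (Polynomial.monomial k a).evalEval v.1 v.2) =
        fun v => a.eval v.1 * v.2 ^ k := by
      ext v
      simp [Polynomial.evalEval, Polynomial.eval_monomial]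
    rw [this]
    have h1 : ContDiff ℂ n fun x : ℂ => a.eval x := by
      simpa using a.contDiff_aeval (𝕜 := ℂ) n
    exact (h1.comp contDiff_fst).mul (contDiff_snd.pow k)

/-- The restriction of a bivariate polynomial to the vertical line at abscissa `x`. -/
abbrev fibre (f : ℂ[X][X]) (x : ℂ) : ℂ[X] := f.map (Polynomial.evalRingHom x)

lemma eval_fibre (f : ℂ[X][X]) (x y : ℂ) : (fibre f x).eval y = f.evalEval x y :=
  Polynomial.map_evalRingHom_eval x y f

lemma contDiff_eval_fibre (f : ℂ[X][X]) {n : WithTop ℕ∞} :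
    ContDiff ℂ n fun v : ℂ × ℂ => (fibre f v.1).eval v.2 := by
  simpa only [eval_fibre] using contDiff_evalEval f

lemma exists_root_bound {f : ℂ[X][X]} (hf : f.Monic) : ∃ u : ℂ → ℝ, PolynomialGrowth u ∧
    (∀ x, 1 ≤ u x) ∧ ∀ x y, f.evalEval x y = 0 → ‖y‖ ≤ u x := by
  refine ⟨fun x => 1 + ∑ i ∈ Finset.range f.natDegree, ‖(f.coeff i).eval x‖,
    (PolynomialGrowth.const 1).add (PolynomialGrowth.sum _ fun i =>
      PolynomialGrowth.norm_eval (f.coeff i)), fun x => ?_, fun x y h => ?_⟩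
  · have : 0 ≤ ∑ i ∈ Finset.range f.natDegree, ‖(f.coeff i).eval x‖ := by positivity
    linarith
  · have hm : (fibre f x).Monic := hf.map _
    have h1 := Polynomial.IsRoot.norm_lt_cauchyBound hm.ne_zero
      (show (fibre f x).IsRoot y by rwa [Polynomial.IsRoot, eval_fibre])
    have h2 : Polynomial.cauchyBound (fibre f x) ≤
        1 + ∑ i ∈ Finset.range f.natDegree, ‖(f.coeff i).eval x‖₊ := by
      rw [Polynomial.cauchyBound, hm.leadingCoeff, nnnorm_one, div_one, add_comm,
        hf.natDegree_map]
      gcongr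
      refine Finset.sup_le fun i hi => ?_
      rw [Polynomial.coeff_map, Polynomial.coe_evalRingHom]
      exact Finset.single_le_sum (f := fun i => ‖(f.coeff i).eval x‖₊)
        (fun _ _ => zero_le) hi
    have h3 := (h1.trans_le h2).le
    simpa using NNReal.coe_le_coe.2 h3

lemma differentiableAt_coeff_prod {ι : Type*} (I : Finset ι) {σ : ι → ℂ → ℂ} {x : ℂ}
    (hσ : ∀ i, DifferentiableAt ℂ (σ i) x) (j : ℕ) :
    DifferentiableAt ℂ
      (fun x => (∏ i ∈ I, (Polynomial.X - Polynomial.C (σ i x))).coeff j) x := by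
  classical
  induction I using Finset.induction_on generalizing j with
  | empty => simp
  | insert a I ha ih =>
    simp only [Finset.prod_insert ha, sub_mul, Polynomial.coeff_sub, Polynomial.coeff_C_mul]
    refine DifferentiableAt.sub ?_ ((hσ a).mul (ih j))
    cases j with
    | zero => simp
    | succ j => simpa using ih j

lemma sections_joinedIn {E : Type*} [NormedAddCommGroup E] [NormedSpace ℂ E] {F : Type*}
    [TopologicalSpace F] {T : Set (E × F)} {e₀ : E} {r : ℝ} {s : E → F}
    (hs : ContinuousOn s (Metric.ball e₀ r))
    (hT : ∀ e ∈ Metric.ball e₀ r, (e, s e) ∈ T) {e e' : E}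
    (he : e ∈ Metric.ball e₀ r) (he' : e' ∈ Metric.ball e₀ r) :
    JoinedIn T (e, s e) (e', s e') := by
  let _ : NormedSpace ℝ E := NormedSpace.restrictScalars ℝ ℂ E
  have h := ((convex_ball e₀ r).isPathConnected ⟨e, he⟩).joinedIn e he e' he'
  have h2 := h.map_continuousOn (continuousOn_id.prodMk hs)
  refine h2.mono ?_
  rintro _ ⟨a, ha, rfl⟩
  exact hT a ha

/-- The part of an irreducible curve lying over the complement of a finite set of abscissae
containing the branch points is path connected. -/
theorem joinedIn_of_irreducible {f : ℂ[X][X]} (hf : f.Monic) (hirr : Irreducible f)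
    (S : Finset ℂ) (hS : ∀ x ∉ S, (fibre f x).Separable) {p q : ℂ × ℂ}
    (hp : p.1 ∉ S) (hp0 : f.evalEval p.1 p.2 = 0) (hq : q.1 ∉ S) (hq0 : f.evalEval q.1 q.2 = 0) :
    JoinedIn {v : ℂ × ℂ | v.1 ∉ S ∧ f.evalEval v.1 v.2 = 0} p q := by
  classical
  set T : Set (ℂ × ℂ) := {v : ℂ × ℂ | v.1 ∉ S ∧ f.evalEval v.1 v.2 = 0} with hT
  have hpT : p ∈ T := ⟨hp, hp0⟩
  have hmon : ∀ x, (fibre f x).Monic := fun x => hf.map _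
  have hdeg : ∀ x, (fibre f x).natDegree = f.natDegree := fun x => hf.natDegree_map _
  let K : ℂ → Finset ℂ := fun x =>
    (fibre f x).roots.toFinset.filter fun y => JoinedIn T p (x, y)
  have hK : ∀ x y, y ∈ K x ↔ JoinedIn T p (x, y) := by
    intro x y
    simp only [K, Finset.mem_filter, Multiset.mem_toFinset, and_iff_right_iff_imp]
    intro h
    rw [Polynomial.mem_roots (hmon x).ne_zero, Polynomial.IsRoot, eval_fibre]
    exact h.target_mem.2
  let P : ℂ → ℂ[X] := fun x => ∏ y ∈ K x, (Polynomial.X - Polynomial.C y)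
  have hPmon : ∀ x, (P x).Monic := fun x => Polynomial.monic_prod_X_sub_C _ _
  have hPdvd : ∀ x, P x ∣ fibre f x := by
    intro x
    refine dvd_trans ?_ (Polynomial.prod_multiset_X_sub_C_dvd (fibre f x))
    show ((K x).val.map fun y => Polynomial.X - Polynomial.C y).prod ∣ _
    refine Multiset.prod_dvd_prod_of_le (Multiset.map_le_map ?_)
    refine (Finset.val_le_iff.2 (Finset.filter_subset _ _)).trans ?_
    exact Multiset.dedup_le _
  have hPdeg : ∀ x, (P x).natDegree ≤ f.natDegree := fun x => by
    rw [← hdeg x]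
    exact Polynomial.natDegree_le_of_dvd (hPdvd x) (hmon x).ne_zero
  have hdiff : ∀ j, ∀ x ∉ S, DifferentiableAt ℂ (fun x => (P x).coeff j) x := by
    intro j x₀ hx₀
    obtain ⟨y, hy, hyr⟩ := exists_injective_roots (hdeg x₀) (hS x₀ hx₀)
    have hcfg : (x₀, y) ∈ rootConfigurations (fibre f) f.natDegree :=
      ⟨(hmon x₀).ne_zero, hy, hyr⟩
    obtain ⟨σ, h1, h2, r, hr, h3, h4⟩ := exists_ball_sections (contDiff_eval_fibre f)
      (fun x => (hdeg x).le) hcfg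
    obtain ⟨r', hr', hSr⟩ := Metric.eventually_nhds_iff_ball.1
      ((S.finite_toSet.isClosed.isOpen_compl).mem_nhds
        (show x₀ ∈ (S : Set ℂ)ᶜ by simpa using hx₀) : ∀ᶠ x in 𝓝 x₀, x ∈ (S : Set ℂ)ᶜ)
    have hsub : Metric.ball x₀ (min r r') ⊆ Metric.ball x₀ r :=
      Metric.ball_subset_ball (min_le_left _ _)
    have hx₀m : x₀ ∈ Metric.ball x₀ (min r r') := Metric.mem_ball_self (lt_min hr hr')
    let I : Finset (Fin f.natDegree) := Finset.univ.filter fun i => JoinedIn T p (x₀, σ i x₀)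
    have hjoin : ∀ i, ∀ x ∈ Metric.ball x₀ (min r r'), JoinedIn T (x₀, σ i x₀) (x, σ i x) := by
      intro i x hx
      refine sections_joinedIn (T := T) ((h3 i).mono hsub) (fun e he => ⟨?_, ?_⟩) hx₀m hx
      · simpa using hSr e (Metric.ball_subset_ball (min_le_right _ _) he)
      · rw [← eval_fibre]
        exact (h4 e (hsub he)).2.2 i
    have hKI : ∀ x ∈ Metric.ball x₀ (min r r'), K x = I.image fun i => σ i x := by
      intro x hx
      ext y
      rw [hK, Finset.mem_image]
      constructor
      · intro h
        obtain ⟨i, rfl⟩ := exists_eq_of_root (h4 x (hsub hx)).1 (hdeg x).le (h4 x (hsub hx)).2.1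
          (h4 x (hsub hx)).2.2 (z := y) (by rw [eval_fibre]; exact h.target_mem.2)
        exact ⟨i, by simpa [I] using h.trans (hjoin i x hx).symm, rfl⟩
      · rintro ⟨i, hi, rfl⟩
        exact (by simpa [I] using hi : JoinedIn T p (x₀, σ i x₀)).trans (hjoin i x hx)
    refine (differentiableAt_coeff_prod I
      (fun i => (h2 i).differentiableAt one_ne_zero) j).congr_of_eventuallyEq ?_
    filter_upwards [Metric.ball_mem_nhds x₀ (lt_min hr hr')] with x hx
    simp only [P]
    rw [hKI x hx, Finset.prod_image fun a _ b _ h => (h4 x (hsub hx)).2.1 h]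
  obtain ⟨u, hu, hu1, hub⟩ := exists_root_bound hf
  have hcoef : ∀ j, ∃ c : ℂ[X], ∀ x ∉ S, c.eval x = (P x).coeff j := by
    intro j
    refine exists_polynomial_of_growth S (hdiff j)
      (u := fun x => u x ^ f.natDegree * f.natDegree.choose (f.natDegree / 2))
      ((hu.pow (fun x => zero_le_one.trans (hu1 x)) _).mul (.const _) fun _ => by positivity) ?_
    intro x _
    have := Polynomial.coeff_bdd_of_roots_le (RingHom.id ℂ) (hPmon x)
      (IsAlgClosed.splits _) (hPdeg x) (B := u x) (fun z hz => ?_) j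
    · simpa only [Polynomial.map_id, max_eq_left (hu1 x)] using this
    · refine hub x z ?_
      rw [Polynomial.map_id, Polynomial.roots_prod_X_sub_C] at hz
      exact ((hK x z).1 hz).target_mem.2
  choose c hc using hcoef
  let G : ℂ[X][X] := ∑ j ∈ Finset.range (f.natDegree + 1), Polynomial.monomial j (c j)
  have hG : ∀ x ∉ S, fibre G x = P x := by
    intro x hx
    ext j
    simp only [G, fibre, Polynomial.coeff_map, Polynomial.finsetSum_coeff,
      Polynomial.coeff_monomial, Finset.sum_ite_eq', Finset.mem_range]
    split_ifs with h
    · exact hc j x hx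
    · rw [map_zero, Polynomial.coeff_eq_zero_of_natDegree_lt]
      exact (hPdeg x).trans_lt (by omega)
  have hinf : ∀ a b : ℂ[X], (∀ x ∉ S, a.eval x = b.eval x) → a = b := by
    intro a b h
    refine Polynomial.eq_of_infinite_eval_eq a b (Set.Infinite.mono (s := (S : Set ℂ)ᶜ) ?_ ?_)
    · intro x hx
      exact h x (by simpa using hx)
    · exact S.finite_toSet.infinite_compl
  have hGmon : G.Monic := by
    have hG0 : G ≠ 0 := by
      intro h
      have := hG p.1 hp
      rw [h, fibre, Polynomial.map_zero] at this
      exact (hPmon p.1).ne_zero this.symm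
    have hl0 : G.leadingCoeff ≠ 0 := Polynomial.leadingCoeff_ne_zero.2 hG0
    have key : G.leadingCoeff * (G.leadingCoeff - 1) = 0 := by
      refine hinf _ _ fun x hx => ?_
      rw [Polynomial.eval_mul, Polynomial.eval_zero, mul_eq_zero, or_iff_not_imp_left]
      intro hne
      have h1 : (fibre G x).leadingCoeff = G.leadingCoeff.eval x :=
        Polynomial.leadingCoeff_map_of_leadingCoeff_ne_zero (Polynomial.evalRingHom x) hne
      rw [hG x hx, (hPmon x).leadingCoeff] at h1
      simp [← h1]
    exact sub_eq_zero.1 ((mul_eq_zero.1 key).resolve_left hl0)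
  have hGdvd : G ∣ f := by
    rw [← Polynomial.modByMonic_eq_zero_iff_dvd hGmon]
    ext1 j
    refine hinf _ _ fun x hx => ?_
    have h1 : fibre (f %ₘ G) x = 0 := by
      rw [fibre, Polynomial.map_modByMonic _ hGmon, Polynomial.modByMonic_eq_zero_iff_dvd
        (hGmon.map _)]
      rw [show G.map (Polynomial.evalRingHom x) = P x from hG x hx]
      exact hPdvd x
    have := congrArg (fun q => Polynomial.coeff q j) h1
    simpa using this
  have hGf : G = f := by
    refine Polynomial.eq_of_monic_of_associated hGmon hf ?_
    refine (hirr.dvd_iff.1 hGdvd).resolve_left ?_ |>.symm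
    intro hu
    have h1 : G = 1 := hGmon.eq_one_of_isUnit hu
    have h2 := hG p.1 hp
    rw [h1, fibre, Polynomial.map_one] at h2
    have h3 : p.2 ∈ K p.1 := (hK _ _).2 (JoinedIn.refl hpT)
    have h4 : (P p.1).eval p.2 = 0 := by
      simp only [P, Polynomial.eval_prod]
      exact Finset.prod_eq_zero h3 (by simp)
    rw [← h2] at h4
    simp at h4
  have h1 := hG q.1 hq
  rw [hGf] at h1
  have h2 : (P q.1).eval q.2 = 0 := by rw [← h1, eval_fibre, hq0]
  simp only [P, Polynomial.eval_prod] at h2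
  obtain ⟨y, hy, hy0⟩ := Finset.prod_eq_zero_iff.1 h2
  have : q.2 = y := by simpa [sub_eq_zero] using hy0
  rw [← this] at hy
  exact (hK _ _).1 hy

end Bivariate

section Lines

/-- The restriction of a bivariate polynomial to the line `y = e.1 * x + e.2`. -/
def lineRestriction (f : ℂ[X][X]) (e : ℂ × ℂ) : ℂ[X] :=
  f.eval (Polynomial.C e.1 * Polynomial.X + Polynomial.C e.2)

lemma eval_eval_eq_evalEval (f : ℂ[X][X]) (q : ℂ[X]) (x : ℂ) :
    (f.eval q).eval x = f.evalEval x (q.eval x) := by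
  induction f using Polynomial.induction_on' with
  | add p r hp hr => simp [Polynomial.evalEval_add, hp, hr]
  | monomial k a => simp [Polynomial.evalEval, Polynomial.eval_monomial]

lemma eval_lineRestriction (f : ℂ[X][X]) (e : ℂ × ℂ) (x : ℂ) :
    (lineRestriction f e).eval x = f.evalEval x (e.1 * x + e.2) := by
  simp [lineRestriction, eval_eval_eq_evalEval]

lemma contDiff_eval_lineRestriction (f : ℂ[X][X]) {n : WithTop ℕ∞} :
    ContDiff ℂ n fun v : (ℂ × ℂ) × ℂ => (lineRestriction f v.1).eval v.2 := by
  simp only [eval_lineRestriction]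
  exact (contDiff_evalEval f).comp (by fun_prop :
    ContDiff ℂ n fun v : (ℂ × ℂ) × ℂ => (v.2, v.1.1 * v.2 + v.1.2))

lemma continuous_coeff_line_pow (k i : ℕ) : Continuous fun e : ℂ × ℂ =>
    ((Polynomial.C e.1 * Polynomial.X + Polynomial.C e.2) ^ k).coeff i := by
  induction k generalizing i with
  | zero => simpa using continuous_const
  | succ k ih =>
    simp only [pow_succ', add_mul, mul_assoc, Polynomial.coeff_add, Polynomial.coeff_C_mul]
    refine Continuous.add (continuous_fst.mul ?_) (continuous_snd.mul (ih i))
    cases i with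
    | zero => simpa using continuous_const
    | succ i => simpa using ih i

lemma continuous_coeff_lineRestriction (f : ℂ[X][X]) (i : ℕ) :
    Continuous fun e => (lineRestriction f e).coeff i := by
  unfold lineRestriction
  simp only [Polynomial.eval_eq_sum_range, Polynomial.finsetSum_coeff, Polynomial.coeff_mul]
  exact continuous_finsetSum _ fun k _ => continuous_finsetSum _ fun q _ =>
    continuous_const.mul (continuous_coeff_line_pow k q.2)

lemma eventually_root_bound {f : ℂ[X][X]} {d : ℕ} {e₀ : ℂ × ℂ}
    (h : ∀ᶠ e in 𝓝 e₀, (lineRestriction f e).natDegree = d) (h0 : lineRestriction f e₀ ≠ 0) :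
    ∃ R : ℝ, ∀ᶠ e in 𝓝 e₀, ∀ z, (lineRestriction f e).eval z = 0 → ‖z‖ ≤ R := by
  have hc := continuous_coeff_lineRestriction f
  have hlead : (lineRestriction f e₀).coeff d ≠ 0 := by
    rw [← h.self_of_nhds]
    exact Polynomial.leadingCoeff_ne_zero.2 h0
  have hcont : ContinuousAt (fun e => 1 + (∑ i ∈ Finset.range d,
      ‖(lineRestriction f e).coeff i‖) / ‖(lineRestriction f e).coeff d‖) e₀ := by
    refine continuousAt_const.add (ContinuousAt.div ?_ (hc d).norm.continuousAt (by simpa))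
    exact (continuous_finsetSum _ fun i _ => (hc i).norm).continuousAt
  refine ⟨1 + (∑ i ∈ Finset.range d, ‖(lineRestriction f e₀).coeff i‖) /
    ‖(lineRestriction f e₀).coeff d‖ + 1, ?_⟩
  filter_upwards [h, hcont.eventually (gt_mem_nhds (lt_add_one _)),
    (hc d).continuousAt.eventually_ne hlead] with e he hlt hne z hz
  have hp0 : lineRestriction f e ≠ 0 := fun h => hne (by rw [h, Polynomial.coeff_zero])
  have h1 := Polynomial.IsRoot.norm_lt_cauchyBound hp0 hz
  have h2 : Polynomial.cauchyBound (lineRestriction f e) ≤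
      1 + (∑ i ∈ Finset.range d, ‖(lineRestriction f e).coeff i‖₊) /
        ‖(lineRestriction f e).coeff d‖₊ := by
    rw [Polynomial.cauchyBound, Polynomial.leadingCoeff, he, add_comm]
    gcongr
    exact Finset.sup_le fun i hi => Finset.single_le_sum
      (f := fun i => ‖(lineRestriction f e).coeff i‖₊) (fun _ _ => zero_le) hi
  have h3 : ‖z‖ ≤ 1 + (∑ i ∈ Finset.range d, ‖(lineRestriction f e).coeff i‖) /
        ‖(lineRestriction f e).coeff d‖ := by
    simpa using NNReal.coe_le_coe.2 (h1.trans_le h2).le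
  exact h3.trans hlt.le

end Lines

section Branches

open Filter

lemma hasDerivAt_evalEval (f : ℂ[X][X]) {x y : ℂ → ℂ} {x' y' s : ℂ} (hx : HasDerivAt x x' s)
    (hy : HasDerivAt y y' s) :
    HasDerivAt (fun s => f.evalEval (x s) (y s))
      (fderiv ℂ (fun v : ℂ × ℂ => f.evalEval v.1 v.2) (x s, y s) (x', y')) s :=
  (((contDiff_evalEval f (n := 1)).differentiable one_ne_zero _).hasFDerivAt).comp_hasDerivAt s
    (hx.prodMk hy)

lemma fderiv_evalEval_vertical (f : ℂ[X][X]) (x y : ℂ) :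
    fderiv ℂ (fun v : ℂ × ℂ => f.evalEval v.1 v.2) (x, y) (0, 1) =
      (fibre f x).derivative.eval y := by
  have h1 := hasDerivAt_evalEval f (hasDerivAt_const y x) (hasDerivAt_id y)
  have h2 := (fibre f x).hasDerivAt y
  simp only [eval_fibre] at h2
  exact h1.unique h2

lemma hasDerivAt_fderiv_evalEval (f : ℂ[X][X]) {y w : ℂ → ℂ} {y' w' s : ℂ}
    (hy : HasDerivAt y y' s) (hw : HasDerivAt w w' s) :
    HasDerivAt (fun s => fderiv ℂ (fun v : ℂ × ℂ => f.evalEval v.1 v.2) (s, y s) (1, w s))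
      (fderiv ℂ (fderiv ℂ fun v : ℂ × ℂ => f.evalEval v.1 v.2) (s, y s) (1, y') (1, w s) +
        w' * fderiv ℂ (fun v : ℂ × ℂ => f.evalEval v.1 v.2) (s, y s) (0, 1)) s := by
  have hL : ContDiff ℂ 1 (fderiv ℂ fun v : ℂ × ℂ => f.evalEval v.1 v.2) :=
    (contDiff_evalEval f (n := 2)).fderiv_right le_rfl
  have h1 := ((hL.differentiable one_ne_zero (s, y s)).hasFDerivAt).comp_hasDerivAt s
    ((hasDerivAt_id s).prodMk hy)
  have h2 := h1.clm_apply ((hasDerivAt_const s (1 : ℂ)).prodMk hw)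
  have h3 : w' * fderiv ℂ (fun v : ℂ × ℂ => f.evalEval v.1 v.2) (s, y s) (0, 1) =
      fderiv ℂ (fun v : ℂ × ℂ => f.evalEval v.1 v.2) (s, y s) (0, w') := by
    rw [← smul_eq_mul, ← map_smul]
    simp
  rw [h3]
  exact h2

/-- Near a point where the vertical derivative does not vanish, a plane curve is the graph of an
analytic function. -/
lemma exists_branch {f : ℂ[X][X]} {x₀ y₀ : ℂ} (hs : (fibre f x₀).Separable)
    (h0 : f.evalEval x₀ y₀ = 0) :
    ∃ y : ℂ → ℂ, y x₀ = y₀ ∧ AnalyticAt ℂ y x₀ ∧ (∀ᶠ s in 𝓝 x₀, f.evalEval s (y s) = 0) ∧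
      ∀ᶠ v in 𝓝 (x₀, y₀), f.evalEval v.1 v.2 = 0 → y v.1 = v.2 := by
  obtain ⟨y, h1, h2, h3, h4⟩ := exists_implicit_function (contDiff_evalEval f) h0
    (by simpa only [eval_fibre] using (fibre f x₀).hasDerivAt y₀)
    (separable_derivative_eval_ne_zero hs (by rwa [eval_fibre]))
  refine ⟨y, h1, ?_, h3, h4⟩
  rw [Complex.analyticAt_iff_eventually_differentiableAt]
  filter_upwards [h2.eventually (by simp)] with s hs using hs.differentiableAt one_ne_zero

/-- An analytic function is negligible against its derivative near an isolated zero. -/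
lemma isLittleO_deriv {u : ℂ → ℂ} {z : ℂ} (hu : AnalyticAt ℂ u z) (h0 : u z = 0)
    (hne : ¬ ∀ᶠ s in 𝓝 z, u s = 0) : u =o[𝓝 z] deriv u := by
  obtain ⟨n, h, hh, hhz, huh⟩ := (hu.exists_eventuallyEq_pow_smul_nonzero_iff).2 hne
  have hn : n ≠ 0 := by
    rintro rfl
    have := huh.self_of_nhds
    simp [h0, eq_comm, hhz] at this
  obtain ⟨k, rfl⟩ := Nat.exists_eq_succ_of_ne_zero hn
  have hder : ∀ᶠ s in 𝓝 z, deriv u s =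
      (s - z) ^ k * (((k : ℂ) + 1) * h s + (s - z) * deriv h s) := by
    filter_upwards [huh.eventually_nhds, hh.eventually_analyticAt] with s hs hhs
    have h1 : HasDerivAt (fun s => (s - z) ^ (k + 1) • h s)
        (((k : ℂ) + 1) * (s - z) ^ k * h s + (s - z) ^ (k + 1) * deriv h s) s := by
      have h2 : HasDerivAt (fun s => (s - z) ^ (k + 1)) (((k : ℂ) + 1) * (s - z) ^ k) s := by
        simpa using ((hasDerivAt_id' s).sub_const z).fun_pow (k + 1)
      exact h2.fun_mul hhs.differentiableAt.hasDerivAt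
    rw [Filter.EventuallyEq.deriv_eq hs, h1.deriv]
    ring
  have hlim : Tendsto (fun s => (s - z) * h s / (((k : ℂ) + 1) * h s + (s - z) * deriv h s))
      (𝓝 z) (𝓝 0) := by
    have hk : ((k : ℂ) + 1) * h z + (z - z) * deriv h z ≠ 0 := by
      simpa [hhz] using Nat.cast_add_one_ne_zero k
    have hc : ContinuousAt
        (fun s => (s - z) * h s / (((k : ℂ) + 1) * h s + (s - z) * deriv h s)) z := by
      refine ContinuousAt.div ?_ ?_ hk
      · exact (continuousAt_id.sub continuousAt_const).mul hh.continuousAt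
      · exact (continuousAt_const.mul hh.continuousAt).add
          ((continuousAt_id.sub continuousAt_const).mul hh.deriv.continuousAt)
    simpa [ContinuousAt] using hc
  have hne' : ∀ᶠ s in 𝓝 z, ((k : ℂ) + 1) * h s + (s - z) * deriv h s ≠ 0 := by
    have hk : ((k : ℂ) + 1) * h z + (z - z) * deriv h z ≠ 0 := by
      simpa [hhz] using Nat.cast_add_one_ne_zero k
    exact ContinuousAt.eventually_ne ((continuousAt_const.mul hh.continuousAt).add
          ((continuousAt_id.sub continuousAt_const).mul hh.deriv.continuousAt)) hk
  refine (Asymptotics.isLittleO_iff_exists_eq_mul).2 ⟨_, hlim, ?_⟩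
  filter_upwards [huh, hder, hne'] with s h1 h2 h3
  simp only [Pi.mul_apply]
  rw [h1, h2, smul_eq_mul, div_mul_eq_mul_div, eq_div_iff h3, Nat.succ_eq_add_one, pow_succ]
  ring

end Branches

section Tangents

open Filter

lemma derivative_lineRestriction_eval (f : ℂ[X][X]) (e : ℂ × ℂ) (z : ℂ) :
    (lineRestriction f e).derivative.eval z =
      fderiv ℂ (fun v : ℂ × ℂ => f.evalEval v.1 v.2) (z, e.1 * z + e.2) (1, e.1) := by
  have h1 := (lineRestriction f e).hasDerivAt z
  simp only [eval_lineRestriction] at h1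
  have h2 : HasDerivAt (fun s : ℂ => e.1 * s + e.2) e.1 z := by
    simpa using ((hasDerivAt_id' z).const_mul e.1).add_const e.2
  exact h1.unique (hasDerivAt_evalEval f (hasDerivAt_id' z) h2)

lemma continuous_fderiv_evalEval (f : ℂ[X][X]) :
    Continuous (fderiv ℂ fun v : ℂ × ℂ => f.evalEval v.1 v.2) :=
  (contDiff_evalEval f (n := 1)).continuous_fderiv one_ne_zero

lemma continuous_derivative_lineRestriction_eval (f : ℂ[X][X]) :
    Continuous fun v : (ℂ × ℂ) × ℂ => (lineRestriction f v.1).derivative.eval v.2 := by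
  simp only [derivative_lineRestriction_eval]
  exact ((continuous_fderiv_evalEval f).comp (by fun_prop :
    Continuous fun v : (ℂ × ℂ) × ℂ => (v.2, v.1.1 * v.2 + v.1.2))).clm_apply (by fun_prop)

lemma fderiv_branch_eq_zero {f : ℂ[X][X]} {y : ℂ → ℂ} {s : ℂ}
    (hy : DifferentiableAt ℂ y s) (h : ∀ᶠ s in 𝓝 s, f.evalEval s (y s) = 0) :
    fderiv ℂ (fun v : ℂ × ℂ => f.evalEval v.1 v.2) (s, y s) (1, deriv y s) = 0 := by
  have h1 := hasDerivAt_evalEval f (hasDerivAt_id' s) hy.hasDerivAt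
  have h2 : HasDerivAt (fun s => f.evalEval s (y s)) 0 s :=
    (hasDerivAt_const s (0 : ℂ)).congr_of_eventuallyEq h
  exact h1.unique h2

lemma derivative_lineRestriction_eval_branch {f : ℂ[X][X]} {y : ℂ → ℂ} {s : ℂ} {e : ℂ × ℂ}
    (hy : DifferentiableAt ℂ y s) (h : ∀ᶠ s in 𝓝 s, f.evalEval s (y s) = 0)
    (he : y s = e.1 * s + e.2) : (lineRestriction f e).derivative.eval s =
      (e.1 - deriv y s) * (fibre f s).derivative.eval (y s) := by
  have h1 : ((1 : ℂ), e.1) = (1, deriv y s) + (e.1 - deriv y s) • ((0 : ℂ), (1 : ℂ)) := by simp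
  rw [derivative_lineRestriction_eval, ← he, ← fderiv_evalEval_vertical, h1, map_add,
    fderiv_branch_eq_zero hy h, zero_add, map_smul, smul_eq_mul]

lemma eventually_tangent_of_double_root {f : ℂ[X][X]} {y : ℂ → ℂ} {z : ℂ} {e₀ : ℂ × ℂ}
    (hs : (fibre f z).Separable) (hy : AnalyticAt ℂ y z)
    (h : ∀ᶠ s in 𝓝 z, f.evalEval s (y s) = 0)
    (hu : ∀ᶠ v in 𝓝 (z, y z), f.evalEval v.1 v.2 = 0 → y v.1 = v.2)
    (he : y z = e₀.1 * z + e₀.2) :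
    ∀ᶠ v : (ℂ × ℂ) × ℂ in 𝓝 (e₀, z), (lineRestriction f v.1).eval v.2 = 0 →
      (lineRestriction f v.1).derivative.eval v.2 = 0 →
      y v.2 = v.1.1 * v.2 + v.1.2 ∧ deriv y v.2 = v.1.1 := by
  have h1 : Tendsto (fun v : (ℂ × ℂ) × ℂ => (v.2, v.1.1 * v.2 + v.1.2)) (𝓝 (e₀, z))
      (𝓝 (z, y z)) := by
    have : Continuous fun v : (ℂ × ℂ) × ℂ => (v.2, v.1.1 * v.2 + v.1.2) := by fun_prop
    rw [he]
    exact this.tendsto (e₀, z)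
  have h2 : Tendsto (fun v : (ℂ × ℂ) × ℂ => v.2) (𝓝 (e₀, z)) (𝓝 z) := continuous_snd.tendsto _
  have h3 : ∀ᶠ s in 𝓝 z, (fibre f s).derivative.eval (y s) ≠ 0 := by
    have hc : ContinuousAt (fun s => (fibre f s).derivative.eval (y s)) z := by
      simp only [← fderiv_evalEval_vertical]
      exact ((continuous_fderiv_evalEval f).continuousAt.comp
        (continuousAt_id.prodMk hy.continuousAt)).clm_apply continuousAt_const
    exact hc.eventually_ne (separable_derivative_eval_ne_zero hs
      (by rw [eval_fibre]; exact h.self_of_nhds))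
  filter_upwards [h1.eventually hu, h2.eventually h3, h2.eventually hy.eventually_analyticAt,
    h2.eventually h.eventually_nhds] with v hv1 hv2 hv3 hv4 hg hg'
  have hyv := hv1 (by rwa [eval_lineRestriction] at hg)
  rw [derivative_lineRestriction_eval_branch hv3.differentiableAt hv4 hyv, mul_eq_zero] at hg'
  exact ⟨hyv, (sub_eq_zero.1 (hg'.resolve_right hv2)).symm⟩

/-- The coefficients of the tangent line to the graph of `y` at abscissa `s`. -/
def tangentLine (y : ℂ → ℂ) (s : ℂ) : ℂ × ℂ := (deriv y s, y s - s * deriv y s)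

lemma continuousAt_tangentLine {y : ℂ → ℂ} {s : ℂ} (hy : AnalyticAt ℂ y s) :
    ContinuousAt (tangentLine y) s :=
  hy.deriv.continuousAt.prodMk (hy.continuousAt.sub (continuousAt_id.mul hy.deriv.continuousAt))

lemma hasDerivAt_tangentLine_snd {y : ℂ → ℂ} {s : ℂ} (hy : AnalyticAt ℂ y s) :
    HasDerivAt (fun s => (tangentLine y s).2) (-s * deriv (deriv y) s) s := by
  have h := hy.differentiableAt.hasDerivAt.sub
    ((hasDerivAt_id' s).mul hy.deriv.differentiableAt.hasDerivAt)
  rw [show -s * deriv (deriv y) s = deriv y s - (1 * deriv y s + s * deriv (deriv y) s) by ring]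
  exact h

lemma eq_zero_of_eventually_line {f : ℂ[X][X]} {e : ℂ × ℂ} {z : ℂ}
    (h : ∀ᶠ s in 𝓝 z, f.evalEval s (e.1 * s + e.2) = 0) : lineRestriction f e = 0 := by
  refine Polynomial.eq_zero_of_infinite_isRoot _ ?_
  refine (infinite_of_mem_nhds z h).mono fun s hs => ?_
  rw [Set.mem_ofPred_eq, Polynomial.IsRoot, eval_lineRestriction]
  exact hs

lemma eventually_eq_of_double_root_self {f : ℂ[X][X]} {y : ℂ → ℂ} {x : ℂ}
    (hs : (fibre f x).Separable) (hy : AnalyticAt ℂ y x)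
    (h : ∀ᶠ s in 𝓝 x, f.evalEval s (y s) = 0)
    (hu : ∀ᶠ v in 𝓝 (x, y x), f.evalEval v.1 v.2 = 0 → y v.1 = v.2)
    (hA : deriv (deriv y) x ≠ 0) :
    ∀ᶠ v : ℂ × ℂ in 𝓝 (x, x), (lineRestriction f (tangentLine y v.1)).eval v.2 = 0 →
      (lineRestriction f (tangentLine y v.1)).derivative.eval v.2 = 0 → v.2 = v.1 := by
  have h1 := eventually_tangent_of_double_root (e₀ := tangentLine y x) hs hy h hu
    (by simp [tangentLine]; ring)
  have h2 : Tendsto (fun v : ℂ × ℂ => (tangentLine y v.1, v.2)) (𝓝 (x, x))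
      (𝓝 (tangentLine y x, x)) :=
    (ContinuousAt.comp (f := Prod.fst) (x := (x, x)) (continuousAt_tangentLine hy)
      continuousAt_fst).prodMk_nhds continuousAt_snd
  have h3 := (hy.deriv.hasStrictDerivAt).isLittleO.bound (half_pos (norm_pos_iff.2 hA))
  filter_upwards [h2.eventually h1, h3] with v hv1 hv2 hg hg'
  have hd : deriv y v.2 = deriv y v.1 := (hv1 hg hg').2
  by_contra hne
  rw [hd, sub_self, zero_sub, norm_neg] at hv2
  have h4 : 0 < ‖v.1 - v.2‖ := norm_pos_iff.2 (sub_ne_zero.2 (Ne.symm hne))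
  have h5 : 0 < ‖deriv (deriv y) x‖ := norm_pos_iff.2 hA
  simp only [ContinuousLinearMap.toSpanSingleton_apply, smul_eq_mul, norm_mul] at hv2
  nlinarith

lemma eventually_not_double_root_of_ne {f : ℂ[X][X]} {y : ℂ → ℂ} {x z : ℂ}
    (hy : AnalyticAt ℂ y x) (hA : deriv (deriv y) x ≠ 0) (hzx : z ≠ x)
    (hne : lineRestriction f (tangentLine y x) ≠ 0)
    (hz : (lineRestriction f (tangentLine y x)).eval z = 0)
    (hz' : (lineRestriction f (tangentLine y x)).derivative.eval z = 0)
    (hs : (fibre f z).Separable) :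
    ∀ᶠ v : ℂ × ℂ in 𝓝 (x, z), (lineRestriction f (tangentLine y v.1)).eval v.2 = 0 →
      (lineRestriction f (tangentLine y v.1)).derivative.eval v.2 = 0 → v.1 = x := by
  set e₀ := tangentLine y x with he₀
  obtain ⟨η, hη0, hη, hbr, hu⟩ := exists_branch hs
    (show f.evalEval z (e₀.1 * z + e₀.2) = 0 by rwa [eval_lineRestriction] at hz)
  rw [← hη0] at hu
  have hηd : deriv η z = e₀.1 := by
    rw [derivative_lineRestriction_eval_branch hη.differentiableAt hbr hη0, mul_eq_zero] at hz'
    exact (sub_eq_zero.1 (hz'.resolve_right (separable_derivative_eval_ne_zero hs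
      (by rw [eval_fibre]; exact hbr.self_of_nhds)))).symm
  have h1 := eventually_tangent_of_double_root hs hη hbr hu hη0
  have h2 : Tendsto (fun v : ℂ × ℂ => (tangentLine y v.1, v.2)) (𝓝 (x, z)) (𝓝 (e₀, z)) :=
    (ContinuousAt.comp (f := Prod.fst) (x := (x, z)) (continuousAt_tangentLine hy)
      continuousAt_fst).prodMk_nhds continuousAt_snd
  have hfst : Tendsto (fun v : ℂ × ℂ => v.1) (𝓝 (x, z)) (𝓝 x) := continuous_fst.tendsto _
  have hsnd : Tendsto (fun v : ℂ × ℂ => v.2) (𝓝 (x, z)) (𝓝 z) := continuous_snd.tendsto _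
  let u : ℂ → ℂ := fun s => η s - (e₀.1 * s + e₀.2)
  have hlin : AnalyticAt ℂ (fun s : ℂ => e₀.1 * s + e₀.2) z := by fun_prop
  have hua : AnalyticAt ℂ u z := hη.sub hlin
  have hu0 : ¬ ∀ᶠ s in 𝓝 z, u s = 0 := by
    intro h0
    refine hne (eq_zero_of_eventually_line (z := z) ?_)
    filter_upwards [h0, hbr] with s hs1 hs2
    rwa [← sub_eq_zero.1 hs1]
  have huo := isLittleO_deriv hua (by simp [u, hη0]) hu0
  have hud : ∀ᶠ s in 𝓝 z, deriv u s = deriv η s - e₀.1 := by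
    filter_upwards [hη.eventually_analyticAt] with s hs
    have h3 : HasDerivAt (fun s : ℂ => e₀.1 * s + e₀.2) e₀.1 s := by
      simpa using ((hasDerivAt_id' s).const_mul e₀.1).add_const e₀.2
    exact (hs.differentiableAt.hasDerivAt.sub h3).deriv
  set A := deriv (deriv y) x with hAdef
  have hApos : 0 < ‖A‖ := norm_pos_iff.2 hA
  have hδ : 0 < ‖z - x‖ := norm_pos_iff.2 (sub_ne_zero.2 hzx)
  set ε := ‖z - x‖ / 8 with hε
  have hεpos : 0 < ε := by positivity
  have ha := (hasDerivAt_iff_isLittleO.1 hy.deriv.differentiableAt.hasDerivAt).bound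
    (half_pos hApos)
  have hb := (hasDerivAt_iff_isLittleO.1 ((hasDerivAt_tangentLine_snd hy).add
    (hy.deriv.differentiableAt.hasDerivAt.const_mul x))).bound (mul_pos hεpos hApos)
  filter_upwards [h2.eventually h1, hsnd.eventually (huo.bound hεpos), hsnd.eventually hud,
    hfst.eventually ha, hfst.eventually hb,
    hsnd.eventually (Metric.ball_mem_nhds z (half_pos hδ))] with v hv1 hv2 hv3 hv4 hv5 hv6 hg hg'
  obtain ⟨hp, hq⟩ := hv1 hg hg'
  by_contra hne
  have hr : 0 < ‖v.1 - x‖ := norm_pos_iff.2 (sub_ne_zero.2 hne)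
  set α := deriv y v.1 - deriv y x with hα
  set β := (tangentLine y v.1).2 - e₀.2 with hβ
  have e1 : u v.2 = α * v.2 + β := by
    simp only [u, hp, hα, hβ]
    simp only [tangentLine, he₀]
    ring
  have e2 : deriv u v.2 = α := by
    rw [hv3, hq]
    rfl
  rw [e1, e2] at hv2
  have hv4' : ‖α - (v.1 - x) * A‖ ≤ ‖A‖ / 2 * ‖v.1 - x‖ := by simpa [smul_eq_mul] using hv4
  have hv5' : ‖β + x * α‖ ≤ ε * ‖A‖ * ‖v.1 - x‖ := by
    refine le_trans (le_of_eq ?_) hv5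
    congr 1
    simp only [hβ, hα, he₀, smul_eq_mul, Pi.add_apply]
    ring
  have k1 : ‖A‖ / 2 * ‖v.1 - x‖ ≤ ‖α‖ := by
    have := norm_sub_norm_le ((v.1 - x) * A) ((v.1 - x) * A - α)
    rw [sub_sub_cancel, norm_mul, norm_sub_rev _ α] at this
    linarith
  have hαpos : 0 < ‖α‖ := lt_of_lt_of_le (by positivity) k1
  have k2 : ‖α‖ * ‖v.2 - x‖ ≤ ε * ‖α‖ + ε * ‖A‖ * ‖v.1 - x‖ := by
    rw [← norm_mul]
    calc ‖α * (v.2 - x)‖ = ‖(α * v.2 + β) - (β + x * α)‖ := by congr 1; ring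
      _ ≤ _ := (norm_sub_le _ _).trans (add_le_add hv2 hv5')
  have k3 : ‖α‖ * ‖v.2 - x‖ ≤ 3 * ε * ‖α‖ := by nlinarith
  have k4 : ‖v.2 - x‖ ≤ 3 * ε := by nlinarith
  have k5 : ‖z - x‖ ≤ ‖v.2 - z‖ + ‖v.2 - x‖ := by
    have := norm_sub_le (v.2 - x) (v.2 - z)
    rw [sub_sub_sub_cancel_left] at this
    linarith
  have k6 : ‖v.2 - z‖ < ‖z - x‖ / 2 := by simpa [dist_eq_norm] using hv6
  rw [hε] at k4
  linarith

end Tangents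

section SimpleTangents

open Filter

lemma lineRestriction_tangentLine_eval {f : ℂ[X][X]} {y : ℂ → ℂ} {m : ℂ}
    (h : f.evalEval m (y m) = 0) : (lineRestriction f (tangentLine y m)).eval m = 0 := by
  rw [eval_lineRestriction, ← h]
  congr 1
  simp only [tangentLine]
  ring

lemma lineRestriction_tangentLine_derivative_eval {f : ℂ[X][X]} {y : ℂ → ℂ} {m : ℂ}
    (hy : AnalyticAt ℂ y m) (h : ∀ᶠ s in 𝓝 m, f.evalEval s (y s) = 0) :
    (lineRestriction f (tangentLine y m)).derivative.eval m = 0 := by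
  rw [derivative_lineRestriction_eval_branch hy.differentiableAt h
    (by simp only [tangentLine]; ring)]
  simp [tangentLine]

lemma lineRestriction_tangentLine_second_derivative {f : ℂ[X][X]} {y : ℂ → ℂ} {m : ℂ}
    (hs : (fibre f m).Separable) (hy : AnalyticAt ℂ y m)
    (h : ∀ᶠ s in 𝓝 m, f.evalEval s (y s) = 0) (hA : deriv (deriv y) m ≠ 0) :
    (lineRestriction f (tangentLine y m)).derivative.derivative.eval m ≠ 0 := by
  have h1 := hasDerivAt_fderiv_evalEval f hy.differentiableAt.hasDerivAt
    hy.deriv.differentiableAt.hasDerivAt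
  have h2 : HasDerivAt (fun s => fderiv ℂ (fun v : ℂ × ℂ => f.evalEval v.1 v.2) (s, y s)
      (1, deriv y s)) 0 m := by
    refine (hasDerivAt_const m (0 : ℂ)).congr_of_eventuallyEq ?_
    filter_upwards [h.eventually_nhds, hy.eventually_analyticAt] with s hs1 hs2
    exact fderiv_branch_eq_zero hs2.differentiableAt hs1
  have h3 := h1.unique h2
  set e := tangentLine y m with he
  have hem : e.1 * m + e.2 = y m := by
    simp only [he, tangentLine]
    ring
  have hl : HasDerivAt (fun s : ℂ => e.1 * s + e.2) e.1 m := by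
    simpa using ((hasDerivAt_id' m).const_mul e.1).add_const e.2
  have h4 := hasDerivAt_fderiv_evalEval f hl (hasDerivAt_const m e.1)
  have h5 := (lineRestriction f e).derivative.hasDerivAt m
  simp only [derivative_lineRestriction_eval] at h5
  have h6 := h5.unique h4
  rw [zero_mul, add_zero, hem] at h6
  rw [h6]
  intro h7
  rw [show e.1 = deriv y m from rfl] at h7
  rw [h7, zero_add, fderiv_evalEval_vertical, mul_eq_zero] at h3
  exact h3.elim hA (separable_derivative_eval_ne_zero hs
    (by rw [eval_fibre]; exact h.self_of_nhds))

lemma eventually_component {f f₁ : ℂ[X][X]} (hdvd : f₁ ∣ f) {y : ℂ → ℂ} {x : ℂ}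
    (hs : (fibre f x).Separable) (hy : ContinuousAt y x)
    (h : ∀ᶠ s in 𝓝 x, f.evalEval s (y s) = 0) (h₁ : f₁.evalEval x (y x) = 0) :
    ∀ᶠ s in 𝓝 x, f₁.evalEval s (y s) = 0 := by
  obtain ⟨k, rfl⟩ := hdvd
  have hk : k.evalEval x (y x) ≠ 0 := by
    intro hk
    refine separable_derivative_eval_ne_zero hs (z := y x) ?_ ?_
    · rw [eval_fibre]
      exact h.self_of_nhds
    · rw [← eval_fibre] at hk h₁
      simp [fibre, Polynomial.derivative_mul] at hk h₁ ⊢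
      simp [hk, h₁]
  have hc : ContinuousAt (fun s => k.evalEval s (y s)) x :=
    ((contDiff_evalEval k (n := 0)).continuous.continuousAt).comp (continuousAt_id.prodMk hy)
  filter_upwards [h, hc.eventually_ne hk] with s h1 h2
  rw [Polynomial.evalEval_mul, mul_eq_zero] at h1
  exact h1.resolve_right h2

lemma lineRestriction_ne_zero {f : ℂ[X][X]} (hirr : Irreducible f) (h2 : 2 ≤ f.natDegree)
    (e : ℂ × ℂ) : lineRestriction f e ≠ 0 := by
  intro h
  have h1 : Polynomial.X - Polynomial.C (Polynomial.C e.1 * Polynomial.X + Polynomial.C e.2) ∣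
      f := Polynomial.dvd_iff_isRoot.2 h
  have h3 := (hirr.dvd_iff.1 h1).resolve_left (Polynomial.not_isUnit_X_sub_C _)
  have h4 := Polynomial.natDegree_eq_of_degree_eq (Polynomial.degree_eq_degree_of_associated h3)
  rw [Polynomial.natDegree_X_sub_C] at h4
  omega

lemma not_eventually_second_deriv_eq_zero {f : ℂ[X][X]} (hirr : Irreducible f)
    (h2 : 2 ≤ f.natDegree) {y : ℂ → ℂ} {x : ℂ} (hy : AnalyticAt ℂ y x)
    (h : ∀ᶠ s in 𝓝 x, f.evalEval s (y s) = 0) :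
    ¬ ∀ᶠ s in 𝓝 x, deriv (deriv y) s = 0 := by
  intro h0
  refine lineRestriction_ne_zero hirr h2 (tangentLine y x)
    (eq_zero_of_eventually_line (z := x) ?_)
  obtain ⟨r, hr, hb⟩ := Metric.eventually_nhds_iff_ball.1 (h0.and hy.eventually_analyticAt)
  have hconst : ∀ s ∈ Metric.ball x r, deriv y s = deriv y x := fun s hs =>
    (Metric.isOpen_ball.is_const_of_deriv_eq_zero (convex_ball x r).isPreconnected
      (fun s hs => (hb s hs).2.deriv.differentiableAt.differentiableWithinAt)
      (fun s hs => (hb s hs).1) hs (Metric.mem_ball_self hr))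
  have hlin : ∀ s ∈ Metric.ball x r, y s - deriv y x * s = y x - deriv y x * x := fun s hs => by
    refine Metric.isOpen_ball.is_const_of_deriv_eq_zero (𝕜 := ℂ)
      (f := fun s => y s - deriv y x * s) (convex_ball x r).isPreconnected
      (fun s hs => ?_) (fun s hs => ?_) hs (Metric.mem_ball_self hr)
    · exact ((hb s hs).2.differentiableAt.sub (by fun_prop)).differentiableWithinAt
    · have h1 : HasDerivAt (fun s => deriv y x * s) (deriv y x) s := by
        simpa using (hasDerivAt_id' s).const_mul (deriv y x)
      refine ((hb s hs).2.differentiableAt.hasDerivAt.fun_sub h1).deriv.trans ?_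
      simp [hconst s hs]
  filter_upwards [h, Metric.ball_mem_nhds x hr] with s hs1 hs2
  rw [← hs1]
  congr 1
  simp only [tangentLine]
  linear_combination -(hlin s hs2)

/-- A nonlinear irreducible component has a tangent line which is tangent to the curve at a single
point, with contact of order two, and is not parallel to finitely many given directions. -/
lemma exists_simple_tangent {f f₁ : ℂ[X][X]} (hdvd : f₁ ∣ f) (hirr : Irreducible f₁)
    (hmon : f₁.Monic) (h2 : 2 ≤ f₁.natDegree) (Δ : Finset ℂ)
    (hΔ : ∀ x ∉ Δ, (fibre f x).Separable) (hf0 : ∀ x, fibre f x ≠ 0) {d : ℕ} (hd : 1 ≤ d)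
    (N : Finset ℂ) (hN : ∀ a ∉ N, ∀ b, (lineRestriction f (a, b)).natDegree = d) :
    ∃ (m : ℂ) (y : ℂ → ℂ), m ∉ Δ ∧ AnalyticAt ℂ y m ∧ (∀ᶠ s in 𝓝 m, f₁.evalEval s (y s) = 0) ∧
      deriv y m ∉ N ∧ deriv (deriv y) m ≠ 0 ∧
      ∀ z ≠ m, (lineRestriction f (tangentLine y m)).eval z = 0 →
        (lineRestriction f (tangentLine y m)).derivative.eval z ≠ 0 := by
  have hΔo : ∀ x ∉ Δ, ∀ᶠ s in 𝓝 x, s ∉ Δ := fun x hx =>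
    (Δ.finite_toSet.isClosed.isOpen_compl).mem_nhds (by simpa using hx)
  have hNo : ∀ x ∉ N, ∀ᶠ s in 𝓝 x, s ∉ N := fun x hx =>
    (N.finite_toSet.isClosed.isOpen_compl).mem_nhds (by simpa using hx)
  have hsub : ∀ {y : ℂ → ℂ} {x : ℂ}, (∀ᶠ s in 𝓝 x, f₁.evalEval s (y s) = 0) →
      ∀ᶠ s in 𝓝 x, f.evalEval s (y s) = 0 := by
    intro y x h
    obtain ⟨k, rfl⟩ := hdvd
    filter_upwards [h] with s hs
    rw [Polynomial.evalEval_mul, hs, zero_mul]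
  obtain ⟨x₀, hx₀⟩ := Δ.exists_notMem
  obtain ⟨y₀, hy₀⟩ := IsAlgClosed.exists_root (fibre f₁ x₀) (by
    rw [Polynomial.degree_eq_natDegree (hmon.map _).ne_zero, hmon.natDegree_map]
    exact_mod_cast (by omega : f₁.natDegree ≠ 0))
  rw [Polynomial.IsRoot, eval_fibre] at hy₀
  obtain ⟨y, hyx, hy, hbr, hu⟩ := exists_branch (hΔ x₀ hx₀) (y₀ := y₀) (by
    obtain ⟨k, rfl⟩ := hdvd
    rw [Polynomial.evalEval_mul, hy₀, zero_mul])
  rw [← hyx] at hy₀ hu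
  have hbr₁ := eventually_component hdvd (hΔ x₀ hx₀) hy.continuousAt hbr hy₀
  let nice : ℂ → Prop := fun s => s ∉ Δ ∧ AnalyticAt ℂ y s ∧
    (∀ᶠ t in 𝓝 s, f₁.evalEval t (y t) = 0) ∧
    (∀ᶠ v in 𝓝 (s, y s), f.evalEval v.1 v.2 = 0 → y v.1 = v.2) ∧ deriv (deriv y) s ≠ 0
  have hnice : ∀ s, nice s → ∀ᶠ t in 𝓝 s, nice t := by
    rintro s ⟨h1, h2, h3, h4, h5⟩
    have hc : Tendsto (fun t => (t, y t)) (𝓝 s) (𝓝 (s, y s)) :=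
      continuousAt_id.prodMk h2.continuousAt
    filter_upwards [hΔo s h1, h2.eventually_analyticAt, h3.eventually_nhds,
      hc.eventually h4.eventually_nhds, h2.deriv.deriv.continuousAt.eventually_ne h5]
      with t k1 k2 k3 k4 k5 using ⟨k1, k2, k3, k4, k5⟩
  obtain ⟨x₁, hx₁⟩ : ∃ x₁, nice x₁ := by
    have hc : Tendsto (fun t => (t, y t)) (𝓝 x₀) (𝓝 (x₀, y x₀)) :=
      continuousAt_id.prodMk hy.continuousAt
    have h5 := (hy.deriv.deriv.eventually_eq_zero_or_eventually_ne_zero).resolve_left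
      (not_eventually_second_deriv_eq_zero hirr h2 hy hbr₁)
    have : ∀ᶠ t in 𝓝[≠] x₀, nice t := by
      filter_upwards [h5, nhdsWithin_le_nhds (hΔo x₀ hx₀),
        nhdsWithin_le_nhds hy.eventually_analyticAt, nhdsWithin_le_nhds hbr₁.eventually_nhds,
        nhdsWithin_le_nhds (hc.eventually hu.eventually_nhds)] with t k5 k1 k2 k3 k4
      exact ⟨k1, k2, k3, k4, k5⟩
    exact this.exists
  obtain ⟨x₂, hx₂, hx₂N, hx₂Q⟩ : ∃ x₂, nice x₂ ∧ deriv y x₂ ∉ N ∧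
      ∀ z ∈ Δ, (lineRestriction f (tangentLine y x₂)).eval z ≠ 0 := by
    obtain ⟨h1, h2, h3, h4, h5⟩ := id hx₁
    have hN' : ∀ᶠ t in 𝓝[≠] x₁, ∀ n ∈ N, deriv y t ≠ n :=
      (Filter.eventually_all_finset N).2 fun n _ =>
        h2.deriv.differentiableAt.hasDerivAt.eventually_ne h5
    have hQ' : ∀ᶠ t in 𝓝[≠] x₁, ∀ z ∈ Δ, ∀ q ∈ (fibre f z).roots.toFinset,
        (tangentLine y t).1 * z + (tangentLine y t).2 ≠ q := by
      refine (Filter.eventually_all_finset Δ).2 fun z hz =>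
        (Filter.eventually_all_finset _).2 fun q _ => ?_
      have hd := (h2.deriv.differentiableAt.hasDerivAt.mul_const z).add
        (hasDerivAt_tangentLine_snd h2)
      refine hd.eventually_ne ?_
      rw [show deriv (deriv y) x₁ * z + -x₁ * deriv (deriv y) x₁ =
        deriv (deriv y) x₁ * (z - x₁) by ring]
      refine mul_ne_zero h5 (sub_ne_zero.2 ?_)
      rintro rfl
      exact h1 hz
    have hn' : ∀ᶠ t in 𝓝[≠] x₁, nice t := nhdsWithin_le_nhds (hnice x₁ hx₁)
    obtain ⟨x₂, k1, k2, k3⟩ := (hn'.and (hN'.and hQ')).exists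
    refine ⟨x₂, k1, fun h => k2 _ h rfl, fun z hz h0 => k3 z hz _ ?_ rfl⟩
    rw [Multiset.mem_toFinset, Polynomial.mem_roots (hf0 z), Polynomial.IsRoot, eval_fibre,
      ← eval_lineRestriction, h0]
  obtain ⟨h1, h2', h3, h4, h5⟩ := id hx₂
  have hct := continuousAt_tangentLine h2'
  have hdeg : ∀ᶠ e in 𝓝 (tangentLine y x₂), (lineRestriction f e).natDegree = d := by
    filter_upwards [(continuous_fst.tendsto (tangentLine y x₂)).eventually (hNo _ hx₂N)] with e he
    exact hN e.1 he e.2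
  have hne : lineRestriction f (tangentLine y x₂) ≠ 0 := by
    intro h0
    have := hdeg.self_of_nhds
    rw [h0, Polynomial.natDegree_zero] at this
    omega
  obtain ⟨R, hR⟩ := eventually_root_bound hdeg hne
  have hpt : ∀ z ∈ Metric.closedBall (0 : ℂ) R, ∀ᶠ v : ℂ × ℂ in 𝓝 (x₂, z),
      (lineRestriction f (tangentLine y v.1)).eval v.2 = 0 →
      (lineRestriction f (tangentLine y v.1)).derivative.eval v.2 = 0 → v.1 = x₂ ∨ v.2 = v.1 := by
    intro z _
    have hct' : ContinuousAt (fun v : ℂ × ℂ => (tangentLine y v.1, v.2)) (x₂, z) :=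
      (ContinuousAt.comp (f := Prod.fst) (x := (x₂, z)) hct continuousAt_fst).prodMk
        continuousAt_snd
    by_cases hz : (lineRestriction f (tangentLine y x₂)).eval z = 0
    swap
    · have hc := ContinuousAt.comp (f := fun v : ℂ × ℂ => (tangentLine y v.1, v.2)) (x := (x₂, z))
        ((contDiff_eval_lineRestriction f (n := 0)).continuous.continuousAt) hct'
      filter_upwards [hc.eventually_ne hz] with v hv hv' using absurd hv' hv
    by_cases hz' : (lineRestriction f (tangentLine y x₂)).derivative.eval z = 0
    swap
    · have hc := ContinuousAt.comp (f := fun v : ℂ × ℂ => (tangentLine y v.1, v.2)) (x := (x₂, z))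
        ((continuous_derivative_lineRestriction_eval f).continuousAt) hct'
      filter_upwards [hc.eventually_ne hz'] with v hv _ hv' using absurd hv' hv
    by_cases hzx : z = x₂
    · subst hzx
      filter_upwards [eventually_eq_of_double_root_self (hΔ z h1) h2' (hsub h3) h4 h5]
        with v hv k1 k2 using Or.inr (hv k1 k2)
    · filter_upwards [eventually_not_double_root_of_ne h2' h5 hzx hne hz hz'
        (hΔ z fun h => hx₂Q z h hz)] with v hv k1 k2 using Or.inl (hv k1 k2)
  have hall := (isCompact_closedBall (0 : ℂ) R).eventually_forall_of_forall_eventually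
    (P := fun s z => (lineRestriction f (tangentLine y s)).eval z = 0 →
      (lineRestriction f (tangentLine y s)).derivative.eval z = 0 → s = x₂ ∨ z = s) hpt
  have hgen : ∀ᶠ s in 𝓝 x₂, nice s ∧ (∀ z, (lineRestriction f (tangentLine y s)).eval z = 0 →
      ‖z‖ ≤ R) ∧ deriv y s ∉ N :=
    (hnice x₂ hx₂).and ((hct.eventually hR).and
      (h2'.deriv.continuousAt.eventually (hNo _ hx₂N)))
  obtain ⟨m, ⟨hm, hmn, hmR, hmN⟩, hmx⟩ := ((hall.and hgen).filter_mono nhdsWithin_le_nhds |>.and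
    (self_mem_nhdsWithin (s := {x₂}ᶜ))).exists
  obtain ⟨k1, k2, k3, k4, k5⟩ := hmn
  refine ⟨m, y, k1, k2, k3, hmN, k5, fun z hzm hz hz' => ?_⟩
  exact (hm z (by simpa using hmR z hz) hz hz').elim hmx hzm

end SimpleTangents

section LocalSwap

open Filter

lemma exists_secant {y : ℂ → ℂ} {m : ℂ} (hy : AnalyticAt ℂ y m) :
    ∃ ξ : ℂ → ℂ × ℂ, ξ 0 = tangentLine y m ∧ (∀ᶠ w in 𝓝 0, ContinuousAt ξ w) ∧
      (∀ w, ξ (-w) = ξ w) ∧ ∀ w, y (m + w) = (ξ w).1 * (m + w) + (ξ w).2 := by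
  let κ : ℂ → ℂ := fun w => y (m + w) - y (m - w)
  have hκ0 : κ 0 = 0 := by simp [κ]
  have hd : HasDerivAt κ (2 * deriv y m) 0 := by
    have hy' : HasDerivAt y (deriv y m) m := hy.differentiableAt.hasDerivAt
    have h1 : HasDerivAt (fun w => y (m + w)) (deriv y m) 0 :=
      HasDerivAt.comp_const_add m 0 (by simpa using hy')
    have h2 : HasDerivAt (fun w => y (m - w)) (-deriv y m) 0 :=
      HasDerivAt.comp_const_sub m 0 (by simpa using hy')
    have h3 := h1.sub h2
    rwa [sub_neg_eq_add, ← two_mul] at h3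
  have hα : ∀ w ≠ 0, dslope κ 0 w = κ w / w := by
    intro w hw
    rw [dslope_of_ne _ hw, slope_def_field, hκ0, sub_zero, sub_zero]
  have hneg : ∀ w, dslope κ 0 (-w) = dslope κ 0 w := by
    intro w
    by_cases hw : w = 0
    · rw [hw, neg_zero]
    · rw [hα w hw, hα _ (neg_ne_zero.2 hw)]
      simp only [κ, sub_neg_eq_add, ← sub_eq_add_neg]
      rw [div_neg, ← neg_div, neg_sub]
  have hmul : ∀ w, dslope κ 0 w * w = y (m + w) - y (m - w) := by
    intro w
    by_cases hw : w = 0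
    · simp [hw]
    · rw [hα w hw, div_mul_cancel₀ _ hw]
  refine ⟨fun w => (dslope κ 0 w / 2, y (m + w) - dslope κ 0 w / 2 * (m + w)), ?_, ?_, ?_, ?_⟩
  · simp only [dslope_same, hd.deriv, tangentLine, add_zero]
    ext <;> simp
    ring
  · have hp : Tendsto (fun w : ℂ => m + w) (𝓝 0) (𝓝 m) := by
      have h : Continuous fun w : ℂ => m + w := by fun_prop
      simpa using h.tendsto 0
    have hn : Tendsto (fun w : ℂ => m - w) (𝓝 0) (𝓝 m) := by
      have h : Continuous fun w : ℂ => m - w := by fun_prop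
      simpa using h.tendsto 0
    filter_upwards [hp.eventually hy.eventually_analyticAt,
      hn.eventually hy.eventually_analyticAt] with w h1 h2
    have c1 : ContinuousAt (fun w => y (m + w)) w :=
      ContinuousAt.comp (f := fun w => m + w) h1.continuousAt (by fun_prop)
    have c2 : ContinuousAt (fun w => y (m - w)) w :=
      ContinuousAt.comp (f := fun w => m - w) h2.continuousAt (by fun_prop)
    have c3 : ContinuousAt (dslope κ 0) w := by
      by_cases hw : w = 0
      · rw [hw]
        exact continuousAt_dslope_same.2 hd.differentiableAt
      · exact (continuousAt_dslope_of_ne hw).2 (c1.sub c2)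
    exact (c3.div_const 2).prodMk (c1.sub ((c3.div_const 2).mul (by fun_prop)))
  · intro w
    simp only [hneg, Prod.mk.injEq, true_and]
    have := hmul w
    rw [← sub_eq_add_neg]
    linear_combination this
  · intro w
    ring

lemma separable_of_forall_derivative_ne_zero {p : ℂ[X]}
    (h : ∀ z, p.eval z = 0 → p.derivative.eval z ≠ 0) : p.Separable := by
  rw [Polynomial.Separable, Polynomial.isCoprime_iff_aeval_ne_zero_of_isAlgClosed (k := ℂ) ℂ]
  intro a
  by_cases ha : p.eval a = 0
  · exact Or.inr (by simpa using h a ha)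
  · exact Or.inl (by simpa using ha)

/-- The roots of a polynomial all of whose roots are simple except for a double root `m`. -/
lemma exists_simple_roots {p : ℂ[X]} {n : ℕ} (hp : p.natDegree = n + 2) {m : ℂ}
    (h0 : p.eval m = 0) (h1 : p.derivative.eval m = 0) (h2 : p.derivative.derivative.eval m ≠ 0)
    (hs : ∀ z ≠ m, p.eval z = 0 → p.derivative.eval z ≠ 0) :
    ∃ ρ : Fin n → ℂ, Function.Injective ρ ∧ ∀ k, ρ k ≠ m ∧ p.eval (ρ k) = 0 ∧
      p.derivative.eval (ρ k) ≠ 0 := by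
  have hp0 : p ≠ 0 := by
    rintro rfl
    simp at hp
  obtain ⟨q, rfl⟩ := Polynomial.dvd_iff_isRoot.2 h0
  have hqm : q.eval m = 0 := by simpa [Polynomial.derivative_mul] using h1
  obtain ⟨h, rfl⟩ := Polynomial.dvd_iff_isRoot.2 hqm
  have hh0 : h ≠ 0 := by
    rintro rfl
    simp at hp0
  have hX := Polynomial.X_sub_C_ne_zero m
  rw [Polynomial.natDegree_mul hX (mul_ne_zero hX hh0), Polynomial.natDegree_mul hX hh0,
    Polynomial.natDegree_X_sub_C] at hp
  have hhm : h.eval m ≠ 0 := by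
    intro hm
    simp [Polynomial.derivative_mul, hm] at h2
  have hroot : ∀ z, h.eval z = 0 → z ≠ m := by
    rintro z hz rfl
    exact hhm hz
  have hsep : h.Separable := by
    refine separable_of_forall_derivative_ne_zero fun z hz hz' => ?_
    refine hs z (hroot z hz) (by simp [hz]) ?_
    simp [Polynomial.derivative_mul, hz, hz']
  obtain ⟨ρ, hinj, hρ⟩ := exists_injective_roots (show h.natDegree = n by omega) hsep
  exact ⟨ρ, hinj, fun k => ⟨hroot _ (hρ k), by simp [hρ k],
    hs _ (hroot _ (hρ k)) (by simp [hρ k])⟩⟩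

lemma cons_cons_comp_swap {n : ℕ} (a b : ℂ) (ρ : Fin n → ℂ) :
    (Fin.cons a (Fin.cons b ρ : Fin (n + 1) → ℂ) : Fin (n + 2) → ℂ) ∘ Equiv.swap 0 1 =
      Fin.cons b (Fin.cons a ρ : Fin (n + 1) → ℂ) := by
  funext k
  refine Fin.cases ?_ (fun k => ?_) k
  · rw [Function.comp_apply, Equiv.swap_apply_left]
    rfl
  · refine Fin.cases ?_ (fun k => ?_) k
    · rw [Function.comp_apply, Fin.succ_zero_eq_one, Equiv.swap_apply_right]
      rfl
    · rw [Function.comp_apply, Equiv.swap_apply_of_ne_of_ne (by simp [Fin.ext_iff])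
        (by simp [Fin.ext_iff])]
      simp

/-- Turning around a simple tangent line exchanges the two intersection points that collide
there. -/
theorem exists_local_swap {f f₁ : ℂ[X][X]} (hdvd : f₁ ∣ f) (hirr : Irreducible f₁)
    (hmon : f₁.Monic) (h2 : 2 ≤ f₁.natDegree) (Δ : Finset ℂ)
    (hΔ : ∀ x ∉ Δ, (fibre f x).Separable) (hf0 : ∀ x, fibre f x ≠ 0) {d : ℕ} (hd : 1 ≤ d)
    (N : Finset ℂ) (hN : ∀ a ∉ N, ∀ b, (lineRestriction f (a, b)).natDegree = d) :
    ∃ (e : ℂ × ℂ) (t : Fin d → ℂ) (i j : Fin d), i ≠ j ∧ t i ∉ Δ ∧ t j ∉ Δ ∧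
      f₁.evalEval (t i) (e.1 * t i + e.2) = 0 ∧ f₁.evalEval (t j) (e.1 * t j + e.2) = 0 ∧
      JoinedIn (rootConfigurations (lineRestriction f) d) (e, t) (e, t ∘ Equiv.swap i j) := by
  obtain ⟨m, y, hm, hy, hbr₁, hmN, hA, hsimple⟩ :=
    exists_simple_tangent hdvd hirr hmon h2 Δ hΔ hf0 hd N hN
  have hbr : ∀ᶠ s in 𝓝 m, f.evalEval s (y s) = 0 := by
    obtain ⟨k, rfl⟩ := hdvd
    filter_upwards [hbr₁] with s hs
    rw [Polynomial.evalEval_mul, hs, zero_mul]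
  have hg0 := lineRestriction_tangentLine_eval hbr.self_of_nhds
  have hg1 := lineRestriction_tangentLine_derivative_eval hy hbr
  have hg2 := lineRestriction_tangentLine_second_derivative (hΔ m hm) hy hbr hA
  have hdeg := hN _ hmN (tangentLine y m).2
  obtain ⟨n, rfl⟩ : ∃ n, d = n + 2 := by
    refine Nat.exists_eq_add_of_le' ?_
    by_contra! hlt
    have h3 : (lineRestriction f (tangentLine y m)).derivative.derivative = 0 := by
      refine Polynomial.derivative_of_natDegree_zero ?_
      have h4 : (lineRestriction f (tangentLine y m)).derivative.natDegree ≤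
          (lineRestriction f (tangentLine y m)).natDegree - 1 :=
        Polynomial.natDegree_derivative_le _
      rw [show (lineRestriction f (tangentLine y m)).natDegree = d from hdeg] at h4
      omega
    simp [h3] at hg2
  obtain ⟨ρ, hinj, hρ⟩ := exists_simple_roots hdeg hg0 hg1 hg2 hsimple
  obtain ⟨ξ, hξ0, hξc, hξn, hξ⟩ := exists_secant hy
  have hsec : ∀ k, ∃ σ : ℂ × ℂ → ℂ, σ (ξ 0) = ρ k ∧ ContDiffAt ℂ 1 σ (ξ 0) ∧
      ∀ᶠ e in 𝓝 (ξ 0), (lineRestriction f e).eval (σ e) = 0 := by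
    intro k
    obtain ⟨σ, k1, k2, k3, -⟩ := exists_implicit_function (contDiff_eval_lineRestriction f)
      (hρ k).2.1 ((lineRestriction f (tangentLine y m)).hasDerivAt (ρ k)) (hρ k).2.2
    rw [hξ0]
    exact ⟨σ, k1, k2, k3⟩
  choose σ hσ0 hσd hσr using hsec
  have hξt : Tendsto ξ (𝓝 0) (𝓝 (ξ 0)) := hξc.self_of_nhds
  let s : ℂ → Fin n → ℂ := fun w k => σ k (ξ w)
  have hsc : ∀ k, ∀ᶠ w in 𝓝 0, ContinuousAt (fun w => s w k) w := by
    intro k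
    filter_upwards [hξc, hξt.eventually ((hσd k).eventually (by simp))] with w h1 h2
    exact ContinuousAt.comp h2.continuousAt h1
  have hp : Tendsto (fun w : ℂ => m + w) (𝓝 0) (𝓝 m) := by
    have h : Continuous fun w : ℂ => m + w := by fun_prop
    simpa using h.tendsto 0
  have hn : Tendsto (fun w : ℂ => -w) (𝓝 0) (𝓝 0) := by
    simpa using (continuous_neg : Continuous fun w : ℂ => -w).tendsto 0
  have hneg : ∀ w, m + -w = m - w := fun w => (sub_eq_add_neg m w).symm
  have hroot₁ : ∀ᶠ w in 𝓝 0, f₁.evalEval (m + w) ((ξ w).1 * (m + w) + (ξ w).2) = 0 := by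
    filter_upwards [hp.eventually hbr₁] with w hw
    rwa [← hξ]
  have hroot : ∀ᶠ w in 𝓝 0, (lineRestriction f (ξ w)).eval (m + w) = 0 := by
    filter_upwards [hp.eventually hbr] with w hw
    rwa [eval_lineRestriction, ← hξ]
  have hΔo : ∀ᶠ z in 𝓝 m, z ∉ Δ :=
    (Δ.finite_toSet.isClosed.isOpen_compl).mem_nhds (by simpa using hm)
  have hNo : ∀ᶠ w in 𝓝 0, (ξ w).1 ∉ N := by
    have h1 : ∀ᶠ a in 𝓝 (ξ 0).1, a ∉ N :=
      (N.finite_toSet.isClosed.isOpen_compl).mem_nhds (by rw [hξ0]; exact hmN)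
    exact ((continuous_fst.tendsto _).comp hξt).eventually h1
  have hsinj : ∀ᶠ w in 𝓝 0, ∀ k l, k ≠ l → s w k ≠ s w l := by
    rw [Filter.eventually_all]
    intro k
    rw [Filter.eventually_all]
    intro l
    by_cases hkl : k = l
    · simp [hkl]
    have h3 : s 0 k - s 0 l ≠ 0 := by
      simp only [s, hσ0]
      exact sub_ne_zero.2 fun h => hkl (hinj h)
    filter_upwards [((hsc k).self_of_nhds.sub (hsc l).self_of_nhds).eventually_ne h3] with w hw _
    exact sub_ne_zero.1 hw
  have hsm : ∀ᶠ w in 𝓝 0, ∀ k, s w k ≠ m + w := by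
    rw [Filter.eventually_all]
    intro k
    have h3 : s 0 k - (m + 0) ≠ 0 := by
      simp only [s, hσ0, add_zero]
      exact sub_ne_zero.2 (hρ k).1
    have hcm : ContinuousAt (fun w : ℂ => m + w) 0 := by fun_prop
    filter_upwards [((hsc k).self_of_nhds.sub hcm).eventually_ne h3] with w hw
    exact sub_ne_zero.1 hw
  have hgood : ∀ᶠ w in 𝓝 (0 : ℂ), ContinuousAt ξ w ∧ (∀ k, ContinuousAt (fun w => s w k) w) ∧
      (∀ k, (lineRestriction f (ξ w)).eval (s w k) = 0) ∧ (ξ w).1 ∉ N ∧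
      (∀ k l, k ≠ l → s w k ≠ s w l) ∧ (∀ k, s w k ≠ m + w) ∧
      (lineRestriction f (ξ w)).eval (m + w) = 0 ∧ m + w ∉ Δ ∧
      f₁.evalEval (m + w) ((ξ w).1 * (m + w) + (ξ w).2) = 0 := by
    filter_upwards [hξc, Filter.eventually_all.2 hsc,
      Filter.eventually_all.2 fun k => hξt.eventually (hσr k), hNo, hsinj, hsm, hroot,
      hp.eventually hΔo, hroot₁] with w k1 k2 k3 k4 k5 k6 k7 k8 k9
    exact ⟨k1, k2, k3, k4, k5, k6, k7, k8, k9⟩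
  obtain ⟨r, hr, hb⟩ := Metric.eventually_nhds_iff_ball.1 (hgood.and (hn.eventually hgood))
  have hsn : ∀ w, s (-w) = s w := fun w => by simp only [s, hξn]
  let c : ℂ → (ℂ × ℂ) × (Fin (n + 2) → ℂ) := fun w =>
    (ξ w, Fin.cons (m + w) (Fin.cons (m - w) (s w) : Fin (n + 1) → ℂ))
  have hε : (0 : ℝ) < r / 2 := half_pos hr
  have hsub : Metric.sphere (0 : ℂ) (r / 2) ⊆ Metric.ball 0 r := fun w hw => by
    rw [Metric.mem_ball, Metric.mem_sphere.1 hw]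
    exact half_lt_self hr
  have hne0 : ∀ w ∈ Metric.sphere (0 : ℂ) (r / 2), w ≠ 0 := by
    rintro w hw rfl
    simp at hw
    exact hε.ne hw
  have hZ : ∀ w ∈ Metric.sphere (0 : ℂ) (r / 2),
      c w ∈ rootConfigurations (lineRestriction f) (n + 2) := by
    intro w hw
    obtain ⟨⟨-, -, k3, k4, k5, k6, k7, k8, k9⟩, ⟨-, -, -, -, -, k6', k7', -, -⟩⟩ := hb w (hsub hw)
    rw [hsn, hneg] at k6'
    rw [hξn, hneg] at k7'
    refine ⟨fun h0 => ?_, ?_, ?_⟩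
    · have := hN _ k4 (ξ w).2
      rw [show lineRestriction f ((ξ w).1, (ξ w).2) = 0 from h0] at this
      simp at this
    · simp only [c]
      rw [Fin.cons_injective_iff, Fin.cons_injective_iff]
      refine ⟨?_, ?_, fun k l hkl => by_contra fun h => k5 k l h hkl⟩
      · rintro ⟨k, hk⟩
        revert hk
        refine Fin.cases (fun hk => ?_) (fun k hk => ?_) k
        · rw [Fin.cons_zero] at hk
          refine hne0 w hw ?_
          linear_combination (-1 / 2 : ℂ) * hk
        · rw [Fin.cons_succ] at hk
          exact k6 k hk
      · rintro ⟨k, hk⟩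
        exact k6' k hk
    · intro k
      simp only [c]
      refine Fin.cases ?_ (fun k => ?_) k
      · simpa using k7
      · refine Fin.cases ?_ (fun k => ?_) k
        · simpa using k7'
        · simpa using k3 k
  have hcont : ContinuousOn c (Metric.sphere (0 : ℂ) (r / 2)) := by
    intro w hw
    obtain ⟨k1, k2, -⟩ := (hb w (hsub hw)).1
    refine (k1.prodMk (continuousAt_pi.2 fun k => ?_)).continuousWithinAt
    refine Fin.cases ?_ (fun k => ?_) k
    · simp only [Fin.cons_zero]
      fun_prop
    · refine Fin.cases ?_ (fun k => ?_) k
      · simp only [Fin.cons_succ, Fin.cons_zero]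
        fun_prop
      · simpa using k2 k
  let ε : ℂ := ((r / 2 : ℝ) : ℂ)
  have hmem : ε ∈ Metric.sphere (0 : ℂ) (r / 2) := by
    rw [mem_sphere_zero_iff_norm, Complex.norm_real, Real.norm_of_nonneg hε.le]
  have hmem' : -ε ∈ Metric.sphere (0 : ℂ) (r / 2) := by
    rw [mem_sphere_zero_iff_norm, norm_neg]
    exact mem_sphere_zero_iff_norm.1 hmem
  have hj := ((isPathConnected_sphere (by rw [Complex.rank_real_complex]; exact Nat.one_lt_ofNat)
    (0 : ℂ) hε.le).joinedIn ε hmem (-ε) hmem').map_continuousOn hcont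
  have hj' : JoinedIn (rootConfigurations (lineRestriction f) (n + 2)) (c ε) (c (-ε)) := by
    refine hj.mono ?_
    rintro _ ⟨w, hw, rfl⟩
    exact hZ w hw
  obtain ⟨⟨-, -, -, -, -, -, -, k8, k9⟩, ⟨-, -, -, -, -, -, -, k8', k9'⟩⟩ := hb ε (hsub hmem)
  rw [hneg] at k8'
  rw [hξn, hneg] at k9'
  refine ⟨ξ ε, (c ε).2, 0, 1, by simp, by simpa [c] using k8, by simpa [c] using k8',
    by simpa [c] using k9, by simpa [c] using k9', ?_⟩
  have hend : (ξ ε, (c ε).2 ∘ Equiv.swap 0 1) = c (-ε) := by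
    simp only [c]
    rw [cons_cons_comp_swap, hξn, hsn, hneg, sub_neg_eq_add]
  rw [hend]
  exact hj'

end LocalSwap

section Transport

lemma rootConfigurations_comp {E : Type*} {p : E → ℂ[X]} {d : ℕ} {e : E} {x : Fin d → ℂ}
    (hx : (e, x) ∈ rootConfigurations p d) (τ : Equiv.Perm (Fin d)) :
    (e, x ∘ τ) ∈ rootConfigurations p d :=
  ⟨hx.1, hx.2.1.comp τ.injective, fun i => hx.2.2 (τ i)⟩

lemma joinedIn_rootConfigurations_comp {E : Type*} [TopologicalSpace E] {p : E → ℂ[X]}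
    {d : ℕ} {e e' : E} {x x' : Fin d → ℂ}
    (h : JoinedIn (rootConfigurations p d) (e, x) (e', x')) (τ : Equiv.Perm (Fin d)) :
    JoinedIn (rootConfigurations p d) (e, x ∘ τ) (e', x' ∘ τ) := by
  have h1 := h.map_continuousOn (f := fun v : E × (Fin d → ℂ) => (v.1, v.2 ∘ τ))
    (Continuous.continuousOn (by fun_prop))
  refine h1.mono ?_
  rintro _ ⟨v, hv, rfl⟩
  exact rootConfigurations_comp hv τ

lemma exists_perm_of_rootConfigurations {E : Type*} {p : E → ℂ[X]} {d : ℕ}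
    (hdeg : ∀ e, (p e).natDegree ≤ d)
    {e : E} {x x' : Fin d → ℂ} (hx : (e, x) ∈ rootConfigurations p d)
    (hx' : (e, x') ∈ rootConfigurations p d) : ∃ τ : Equiv.Perm (Fin d), x' = x ∘ τ := by
  choose τ hτ using fun i => exists_eq_of_root hx.1 (hdeg e) hx.2.1 hx.2.2 (hx'.2.2 i)
  have hinj : Function.Injective τ := fun i j h => hx'.2.1 (by rw [← hτ i, ← hτ j, h])
  exact ⟨Equiv.ofBijective τ (Finite.injective_iff_bijective.1 hinj), funext fun i => (hτ i).symm⟩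

/-- Labelled roots can be transported along a path of parameters, and the transport agrees with
any given continuous choices of roots. -/
lemma exists_joinedIn_of_path {E : Type*} [NormedAddCommGroup E] [NormedSpace ℂ E]
    [CompleteSpace E] {p : E → ℂ[X]}
    (hp : ContDiff ℂ 1 fun v : E × ℂ => (p v.1).eval v.2)
    {d : ℕ} (hdeg : ∀ e, (p e).natDegree ≤ d) {e : unitInterval → E} (he : Continuous e)
    (hgood : ∀ t, ∃ x, (e t, x) ∈ rootConfigurations p d) (K : Finset (Fin d))
    {ζ : Fin d → unitInterval → ℂ} (hζ : ∀ k ∈ K, Continuous (ζ k))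
    (hζr : ∀ k ∈ K, ∀ t, (p (e t)).eval (ζ k t) = 0) {x : Fin d → ℂ}
    (hx : (e 0, x) ∈ rootConfigurations p d) (hxζ : ∀ k ∈ K, x k = ζ k 0) :
    ∃ x', JoinedIn (rootConfigurations p d) (e 0, x) (e 1, x') ∧ ∀ k ∈ K, x' k = ζ k 1 := by
  let G : unitInterval → Prop := fun t =>
    ∃ x', JoinedIn (rootConfigurations p d) (e 0, x) (e t, x') ∧ ∀ k ∈ K, x' k = ζ k t
  have hG : IsLocallyConstant G := by
    refine IsLocallyConstant.iff_eventually_eq G |>.2 fun t₀ => ?_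
    obtain ⟨x₀, hx₀⟩ := hgood t₀
    obtain ⟨σ, hσ0, hσd, r, hr, hσc, hσ⟩ := exists_ball_sections hp hdeg hx₀
    have hl : ∀ k ∈ K, ∃ l, ∀ᶠ t in 𝓝 t₀, σ l (e t) = ζ k t := by
      intro k hk
      obtain ⟨l, hl⟩ := exists_eq_of_root hx₀.1 (hdeg _) hx₀.2.1 hx₀.2.2 (hζr k hk t₀)
      refine ⟨l, ?_⟩
      have hne : ∀ᶠ t in 𝓝 t₀, ∀ m, m ≠ l → σ m (e t) ≠ ζ k t := by
        rw [Filter.eventually_all]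
        intro m
        by_cases hm : m = l
        · simp [hm]
        have h1 : ContinuousAt (fun t => σ m (e t) - ζ k t) t₀ :=
          (ContinuousAt.comp (hσd m).continuousAt he.continuousAt).sub (hζ k hk).continuousAt
        have h2 : σ m (e t₀) - ζ k t₀ ≠ 0 := by
          rw [hσ0, ← hl]
          exact sub_ne_zero.2 fun h => hm (hx₀.2.1 h)
        filter_upwards [h1.eventually_ne h2] with t ht _
        exact sub_ne_zero.1 ht
      filter_upwards [hne, he.continuousAt.eventually_mem (Metric.ball_mem_nhds _ hr)] with t h1 h2
      obtain ⟨m, hm⟩ := exists_eq_of_root (hσ _ h2).1 (hdeg _) (hσ _ h2).2.1 (hσ _ h2).2.2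
        (hζr k hk t)
      by_cases hml : m = l
      · rwa [← hml]
      · exact absurd hm (h1 m hml)
    choose! l hl using hl
    have hev : ∀ᶠ t in 𝓝 t₀, e t ∈ Metric.ball (e t₀) r ∧ ∀ k ∈ K, σ (l k) (e t) = ζ k t :=
      (he.continuousAt.eventually_mem (Metric.ball_mem_nhds _ hr)).and
        ((Filter.eventually_all_finset K).2 hl)
    have key : ∀ t t', (e t ∈ Metric.ball (e t₀) r ∧ ∀ k ∈ K, σ (l k) (e t) = ζ k t) →
        (e t' ∈ Metric.ball (e t₀) r ∧ ∀ k ∈ K, σ (l k) (e t') = ζ k t') → G t → G t' := by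
      rintro t t' ⟨ht, hlt⟩ ⟨ht', hlt'⟩ ⟨x', hx', hk'⟩
      obtain ⟨τ, rfl⟩ := exists_perm_of_rootConfigurations hdeg (hσ _ ht) hx'.target_mem
      have h1 : JoinedIn (rootConfigurations p d) (e t, fun i => σ i (e t))
          (e t', fun i => σ i (e t')) :=
        sections_joinedIn (s := fun e i => σ i e) (continuousOn_pi.2 hσc) hσ ht ht'
      refine ⟨(fun i => σ i (e t')) ∘ τ, hx'.trans (joinedIn_rootConfigurations_comp h1 τ),
        fun k hk => ?_⟩
      have h2 := (hk' k hk).trans (hlt k hk).symm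
      have h3 : τ k = l k := (hσ _ ht).2.1 h2
      rw [Function.comp_apply, h3, hlt' k hk]
    filter_upwards [hev] with t ht
    exact propext ⟨key t t₀ ht hev.self_of_nhds, key t₀ t hev.self_of_nhds ht⟩
  have h0 : G 0 := ⟨x, JoinedIn.refl hx, hxζ⟩
  have h1 : G 1 = G 0 := hG.apply_eq_of_preconnectedSpace 1 0
  rwa [← h1] at h0

end Transport

section Chords

/-- The slope and intercept of the line through two points with distinct abscissae. -/
def chord (p q : ℂ × ℂ) : ℂ × ℂ :=
  ((q.2 - p.2) / (q.1 - p.1), p.2 - (q.2 - p.2) / (q.1 - p.1) * p.1)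

lemma chord_left (p q : ℂ × ℂ) : (chord p q).1 * p.1 + (chord p q).2 = p.2 := by
  simp [chord]

lemma chord_comm {p q : ℂ × ℂ} (h : p.1 ≠ q.1) : chord p q = chord q p := by
  have h1 : q.1 - p.1 ≠ 0 := sub_ne_zero.2 h.symm
  have h2 : p.1 - q.1 ≠ 0 := sub_ne_zero.2 h
  ext
  · simp only [chord]
    rw [← neg_sub p.2, ← neg_sub p.1, neg_div_neg_eq]
  · simp only [chord]
    field_simp
    ring

lemma chord_right {p q : ℂ × ℂ} (h : p.1 ≠ q.1) : (chord p q).1 * q.1 + (chord p q).2 = q.2 := by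
  rw [chord_comm h, chord_left]

lemma chord_eq_of_mem {e : ℂ × ℂ} {x x' : ℂ} (h : x ≠ x') :
    chord (x, e.1 * x + e.2) (x', e.1 * x' + e.2) = e := by
  have h1 : x' - x ≠ 0 := sub_ne_zero.2 h.symm
  have h2 : (e.1 * x' + e.2 - (e.1 * x + e.2)) / (x' - x) = e.1 := by
    field_simp
    ring
  ext
  · exact h2
  · simp only [chord, h2]
    ring

/-- Pairs of points of a curve spanning a line that meets the curve in `d` distinct points. -/
def chordPairs (f : ℂ[X][X]) (d : ℕ) : Set ((ℂ × ℂ) × (ℂ × ℂ)) :=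
  {v | v.1.1 ≠ v.2.1 ∧ f.evalEval v.1.1 v.1.2 = 0 ∧ f.evalEval v.2.1 v.2.2 = 0 ∧
    ∃ x, (chord v.1 v.2, x) ∈ rootConfigurations (lineRestriction f) d}

lemma chordPairs_swap {f : ℂ[X][X]} {d : ℕ} {p q : ℂ × ℂ} (h : (p, q) ∈ chordPairs f d) :
    (q, p) ∈ chordPairs f d := by
  obtain ⟨h1, h2, h3, h4⟩ := h
  refine ⟨Ne.symm h1, h3, h2, ?_⟩
  rwa [chord_comm (Ne.symm h1)]

lemma exists_joinedIn_of_chordPairs {f : ℂ[X][X]} {d : ℕ}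
    (hdeg : ∀ e, (lineRestriction f e).natDegree ≤ d) {v v' : (ℂ × ℂ) × (ℂ × ℂ)}
    (h : JoinedIn (chordPairs f d) v v') {x : Fin d → ℂ}
    (hx : (chord v.1 v.2, x) ∈ rootConfigurations (lineRestriction f) d) {i j : Fin d}
    (hij : i ≠ j) (hi : x i = v.1.1) (hj : x j = v.2.1) :
    ∃ x', JoinedIn (rootConfigurations (lineRestriction f) d) (chord v.1 v.2, x)
      (chord v'.1 v'.2, x') ∧ x' i = v'.1.1 ∧ x' j = v'.2.1 := by
  obtain ⟨ω, hω⟩ := h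
  have hc := ω.continuous
  have hgood : Continuous fun t => chord (ω t).1 (ω t).2 := by
    have h1 : ∀ t, (ω t).2.1 - (ω t).1.1 ≠ 0 := fun t => sub_ne_zero.2 (hω t).1.symm
    have h2 : Continuous fun t => ((ω t).2.2 - (ω t).1.2) / ((ω t).2.1 - (ω t).1.1) :=
      Continuous.div (by fun_prop) (by fun_prop) h1
    exact h2.prodMk ((by fun_prop : Continuous fun t => (ω t).1.2).sub (h2.mul (by fun_prop)))
  have key := exists_joinedIn_of_path (contDiff_eval_lineRestriction f) hdeg hgood
    (fun t => (hω t).2.2.2) {i, j} (ζ := fun k t => if k = i then (ω t).1.1 else (ω t).2.1)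
    (x := x) (fun k _ => by by_cases hk : k = i <;> simp only [hk, if_true, if_false] <;> fun_prop)
    (fun k _ t => ?_) (by simpa using hx) (fun k hk => ?_)
  · obtain ⟨x', h1, h2⟩ := key
    refine ⟨x', by simpa using h1, ?_, ?_⟩
    · simpa using h2 i (by simp)
    · simpa [hij.symm] using h2 j (by simp)
  · by_cases hk : k = i
    · simp only [hk, if_true, eval_lineRestriction, chord_left]
      exact (hω t).2.1
    · simp only [hk, if_false, eval_lineRestriction, chord_right (hω t).1]
      exact (hω t).2.2.1
  · rcases Finset.mem_insert.1 hk with rfl | hk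
    · simpa using hi
    · rw [Finset.mem_singleton.1 hk]
      simpa [hij.symm] using hj

/-- The universal restriction of a curve to the lines through a point. -/
lemma exists_pencil (f : ℂ[X][X]) (p : ℂ × ℂ) : ∃ g : ℂ[X][X], ∀ a,
    g.map (Polynomial.evalRingHom a) = lineRestriction f (a, p.2 - a * p.1) := by
  refine ⟨f.eval₂ (Polynomial.mapRingHom Polynomial.C) (Polynomial.C Polynomial.X * Polynomial.X +
    Polynomial.C (Polynomial.C p.2 - Polynomial.X * Polynomial.C p.1)), fun a => ?_⟩
  rw [← Polynomial.coe_mapRingHom, Polynomial.hom_eval₂, Polynomial.mapRingHom_comp]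
  have h : (Polynomial.evalRingHom a).comp Polynomial.C = RingHom.id ℂ := by
    ext
    simp
  rw [h, Polynomial.mapRingHom_id, lineRestriction, Polynomial.eval, Polynomial.coe_mapRingHom]
  simp [mul_comm a p.1]

lemma exists_finite_bad_abscissae {f f₁ : ℂ[X][X]} (hdvd : f₁ ∣ f) (hirr : Irreducible f₁)
    (h2 : 2 ≤ f₁.natDegree) {d : ℕ} (hd : 1 ≤ d)
    (hdeg : ∀ e, (lineRestriction f e).natDegree ≤ d) {p q : ℂ × ℂ}
    (hpq : (p, q) ∈ chordPairs f d) :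
    ∃ S : Finset ℂ, ∀ v : ℂ × ℂ, v.1 ∉ S → f₁.evalEval v.1 v.2 = 0 → (p, v) ∈ chordPairs f d := by
  classical
  obtain ⟨g, hg⟩ := exists_pencil f p
  have hgd : g.natDegree ≤ d := by
    refine Polynomial.natDegree_le_iff_coeff_eq_zero.2 fun n hn => ?_
    refine Polynomial.funext fun a => ?_
    have h1 := Polynomial.coeff_map (p := g) (Polynomial.evalRingHom a) n
    rw [hg, Polynomial.coeff_eq_zero_of_natDegree_lt ((hdeg _).trans_lt hn)] at h1
    simpa using h1.symm
  obtain ⟨δ, hδ⟩ := exists_separability_witness g d hd hgd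
  have hδ0 : δ ≠ 0 := by
    rintro rfl
    obtain ⟨-, -, -, x, hx⟩ := hpq
    refine (hδ (Polynomial.evalRingHom (chord p q).1)).2 ?_ (map_zero _)
    rw [hg]
    have h3 : ((chord p q).1, p.2 - (chord p q).1 * p.1) = chord p q := rfl
    rw [h3]
    exact ⟨le_antisymm (hdeg _) (natDegree_le_card_of_roots hx.1 hx.2.1 hx.2.2),
      separable_of_injective_roots hx.1 (hdeg _) hx.2.1 hx.2.2⟩
  refine ⟨insert p.1 (δ.roots.toFinset.biUnion fun a =>
    (lineRestriction f₁ (a, p.2 - a * p.1)).roots.toFinset), fun v hv hv0 => ?_⟩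
  rw [Finset.mem_insert, not_or, Finset.mem_biUnion] at hv
  have hne : p.1 ≠ v.1 := Ne.symm hv.1
  have hv0' : f.evalEval v.1 v.2 = 0 := by
    obtain ⟨k, rfl⟩ := hdvd
    rw [Polynomial.evalEval_mul, hv0, zero_mul]
  have h3 : ((chord p v).1, p.2 - (chord p v).1 * p.1) = chord p v := rfl
  have hδv : Polynomial.evalRingHom (chord p v).1 δ ≠ 0 := by
    intro h
    refine hv.2 ⟨(chord p v).1, ?_, ?_⟩
    · simpa [hδ0] using h
    · rw [h3, Multiset.mem_toFinset, Polynomial.mem_roots (lineRestriction_ne_zero hirr h2 _),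
        Polynomial.IsRoot.def, eval_lineRestriction, chord_right hne, hv0]
  obtain ⟨h4, h5⟩ := (hδ _).1 hδv
  rw [hg, h3] at h4 h5
  obtain ⟨x, hx, hx'⟩ := exists_injective_roots h4 h5
  exact ⟨hne, hpq.2.1, hv0', x, h5.ne_zero, hx, hx'⟩

lemma exists_joinedIn_generic {f : ℂ[X][X]} (S : Finset ℂ) {p : ℂ × ℂ}
    (hp : (fibre f p.1).Separable) (hp0 : f.evalEval p.1 p.2 = 0) :
    ∃ p' : ℂ × ℂ, p'.1 ∉ S ∧ f.evalEval p'.1 p'.2 = 0 ∧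
      JoinedIn ({v : ℂ × ℂ | v.1 ∉ S ∧ f.evalEval v.1 v.2 = 0} ∪ {p}) p p' := by
  obtain ⟨y, hy0, hy, hbr, -⟩ := exists_branch hp hp0
  have hS : ∀ᶠ s in 𝓝 p.1, s ∉ S.erase p.1 :=
    ((S.erase p.1).finite_toSet.isClosed.isOpen_compl).mem_nhds (by simp)
  obtain ⟨r, hr, hb⟩ := Metric.eventually_nhds_iff_ball.1
    ((hS.and hbr).and hy.eventually_continuousAt)
  have hT : ∀ s ∈ Metric.ball p.1 r,
      (s, y s) ∈ {v : ℂ × ℂ | v.1 ∉ S ∧ f.evalEval v.1 v.2 = 0} ∪ {p} := by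
    intro s hs
    by_cases h : s = p.1
    · right
      rw [h, hy0]
      rfl
    · exact Or.inl ⟨fun hsS => (hb s hs).1.1 (Finset.mem_erase.2 ⟨h, hsS⟩), (hb s hs).1.2⟩
  have hs : p.1 + ((r / 2 : ℝ) : ℂ) ∈ Metric.ball p.1 r := by
    rw [mem_ball_iff_norm, add_sub_cancel_left, Complex.norm_real,
      Real.norm_of_nonneg (half_pos hr).le]
    exact half_lt_self hr
  have hne : p.1 + ((r / 2 : ℝ) : ℂ) ≠ p.1 := by
    simpa using hr.ne'
  have h1 := sections_joinedIn (T := {v : ℂ × ℂ | v.1 ∉ S ∧ f.evalEval v.1 v.2 = 0} ∪ {p})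
    (fun s hs => (hb s hs).2.continuousWithinAt) hT (Metric.mem_ball_self hr) hs
  rw [hy0] at h1
  exact ⟨_, fun h => (hb _ hs).1.1 (Finset.mem_erase.2 ⟨hne, h⟩), (hb _ hs).1.2, h1⟩

lemma joinedIn_of_irreducible_endpoints {f : ℂ[X][X]} (hf : f.Monic) (hirr : Irreducible f)
    (Δ S : Finset ℂ) (hΔ : ∀ x ∉ Δ, (fibre f x).Separable) {p q : ℂ × ℂ}
    (hp : p.1 ∉ Δ) (hp0 : f.evalEval p.1 p.2 = 0) (hq : q.1 ∉ Δ) (hq0 : f.evalEval q.1 q.2 = 0) :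
    JoinedIn {v : ℂ × ℂ | f.evalEval v.1 v.2 = 0 ∧ (v.1 ∉ S ∨ v = p ∨ v = q)} p q := by
  classical
  obtain ⟨p', hp', hp0', jp⟩ := exists_joinedIn_generic (S ∪ Δ) (hΔ _ hp) hp0
  obtain ⟨q', hq', hq0', jq⟩ := exists_joinedIn_generic (S ∪ Δ) (hΔ _ hq) hq0
  have j := joinedIn_of_irreducible hf hirr (S ∪ Δ)
    (fun x hx => hΔ x fun h => hx (Finset.mem_union_right _ h)) hp' hp0' hq' hq0'
  refine ((jp.mono ?_).trans (j.mono ?_)).trans (jq.mono ?_).symm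
  · rintro v (⟨h1, h2⟩ | rfl)
    · exact ⟨h2, Or.inl fun h => h1 (Finset.mem_union_left _ h)⟩
    · exact ⟨hp0, Or.inr (Or.inl rfl)⟩
  · rintro v ⟨h1, h2⟩
    exact ⟨h2, Or.inl fun h => h1 (Finset.mem_union_left _ h)⟩
  · rintro v (⟨h1, h2⟩ | rfl)
    · exact ⟨h2, Or.inl fun h => h1 (Finset.mem_union_left _ h)⟩
    · exact ⟨hq0, Or.inr (Or.inr rfl)⟩

end Chords

section AffineMonodromy

lemma exists_perm_pair {d : ℕ} {i j k l : Fin d} (hij : i ≠ j) (hkl : k ≠ l) :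
    ∃ τ : Equiv.Perm (Fin d), τ i = k ∧ τ j = l := by
  refine ⟨(Equiv.swap i k).trans (Equiv.swap (Equiv.swap i k j) l), ?_, by simp⟩
  rw [Equiv.trans_apply, Equiv.swap_apply_left]
  refine Equiv.swap_apply_of_ne_of_ne (fun h => hij ?_) hkl
  exact (Equiv.swap i k).injective ((Equiv.swap_apply_left i k).trans h)

lemma exists_generic_point {f : ℂ[X][X]} (hf : f.Monic) (h : 1 ≤ f.natDegree) (S : Finset ℂ) :
    ∃ q : ℂ × ℂ, q.1 ∉ S ∧ f.evalEval q.1 q.2 = 0 := by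
  obtain ⟨x, hx⟩ := Infinite.exists_notMem_finset S
  have h1 : (fibre f x).degree ≠ 0 := by
    rw [hf.degree_map, Polynomial.degree_eq_natDegree hf.ne_zero]
    exact_mod_cast (by omega : f.natDegree ≠ 0)
  obtain ⟨y, hy⟩ := IsAlgClosed.exists_root _ h1
  exact ⟨(x, y), hx, by rw [← eval_fibre]; exact hy⟩

/-- One endpoint of a chord can be moved along an irreducible component of a curve, the other one
being fixed. -/
lemma joinedIn_chordPairs {f f₁ : ℂ[X][X]} (hdvd : f₁ ∣ f) (hirr : Irreducible f₁)
    (hmon : f₁.Monic) {d : ℕ} (Δ S : Finset ℂ) (hΔ : ∀ x ∉ Δ, (fibre f x).Separable)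
    {p q q' : ℂ × ℂ} (hS : ∀ v : ℂ × ℂ, v.1 ∉ S → f₁.evalEval v.1 v.2 = 0 →
      (p, v) ∈ chordPairs f d)
    (hq : q.1 ∉ Δ) (hq0 : f₁.evalEval q.1 q.2 = 0) (hpq : (p, q) ∈ chordPairs f d)
    (hq' : q'.1 ∉ Δ) (hq'0 : f₁.evalEval q'.1 q'.2 = 0) (hpq' : (p, q') ∈ chordPairs f d) :
    JoinedIn (chordPairs f d) (p, q) (p, q') := by
  have hΔ₁ : ∀ x ∉ Δ, (fibre f₁ x).Separable := fun x hx =>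
    (hΔ x hx).of_dvd (map_dvd (Polynomial.mapRingHom (Polynomial.evalRingHom x)) hdvd)
  have h := joinedIn_of_irreducible_endpoints hmon hirr Δ S hΔ₁ hq hq0 hq' hq'0
  have h' := h.map_continuousOn (f := fun v => (p, v)) (Continuous.continuousOn (by fun_prop))
  refine h'.mono ?_
  rintro _ ⟨v, ⟨hv, hv' | rfl | rfl⟩, rfl⟩
  · exact hS v hv' hv
  · exact hpq
  · exact hpq'

lemma joinedIn_chordPairs_swap {f : ℂ[X][X]} {d : ℕ} {p q p' q' : ℂ × ℂ}
    (h : JoinedIn (chordPairs f d) (p, q) (p', q')) :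
    JoinedIn (chordPairs f d) (q, p) (q', p') := by
  have h' := h.map_continuousOn (f := Prod.swap) (Continuous.continuousOn continuous_swap)
  refine h'.mono ?_
  rintro _ ⟨v, hv, rfl⟩
  exact chordPairs_swap hv

/-- Any two chords of an irreducible component can be deformed into each other. -/
lemma joinedIn_chordPairs_of_irreducible {f f₁ : ℂ[X][X]} (hdvd : f₁ ∣ f) (hirr : Irreducible f₁)
    (hmon : f₁.Monic) (h2 : 2 ≤ f₁.natDegree) (Δ : Finset ℂ)
    (hΔ : ∀ x ∉ Δ, (fibre f x).Separable) {d : ℕ} (hd : 1 ≤ d)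
    (hdeg : ∀ e, (lineRestriction f e).natDegree ≤ d) {p q p' q' : ℂ × ℂ}
    (hp : p.1 ∉ Δ) (hp0 : f₁.evalEval p.1 p.2 = 0) (hq : q.1 ∉ Δ) (hq0 : f₁.evalEval q.1 q.2 = 0)
    (hp' : p'.1 ∉ Δ) (hp'0 : f₁.evalEval p'.1 p'.2 = 0) (hq' : q'.1 ∉ Δ)
    (hq'0 : f₁.evalEval q'.1 q'.2 = 0) (hpq : (p, q) ∈ chordPairs f d)
    (hpq' : (p', q') ∈ chordPairs f d) :
    JoinedIn (chordPairs f d) (p, q) (p', q') := by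
  classical
  obtain ⟨S, hS⟩ := exists_finite_bad_abscissae hdvd hirr h2 hd hdeg hpq
  obtain ⟨S', hS'⟩ := exists_finite_bad_abscissae hdvd hirr h2 hd hdeg hpq'
  obtain ⟨c, hc, hc0⟩ := exists_generic_point hmon (by omega) (S ∪ S' ∪ Δ)
  simp only [Finset.mem_union, not_or] at hc
  obtain ⟨⟨hcS, hcS'⟩, hcΔ⟩ := hc
  have hpc := hS c hcS hc0
  have hpc' := hS' c hcS' hc0
  obtain ⟨S'', hS''⟩ := exists_finite_bad_abscissae hdvd hirr h2 hd hdeg (chordPairs_swap hpc)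
  have j1 := joinedIn_chordPairs hdvd hirr hmon Δ S hΔ hS hq hq0 hpq hcΔ hc0 hpc
  have j2 := joinedIn_chordPairs hdvd hirr hmon Δ S'' hΔ hS'' hp hp0 (chordPairs_swap hpc)
    hp' hp'0 (chordPairs_swap hpc')
  have j3 := joinedIn_chordPairs hdvd hirr hmon Δ S' hΔ hS' hcΔ hc0 hpc' hq' hq'0 hpq'
  exact (j1.trans (joinedIn_chordPairs_swap j2)).trans j3

/-- The intersection points of a line with an affine plane curve can be transposed by monodromy
if they lie on the same irreducible component. -/
theorem joinedIn_rootConfigurations_swap {f f₁ : ℂ[X][X]} (hdvd : f₁ ∣ f)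
    (hirr : Irreducible f₁) (hmon : f₁.Monic) (h2 : 2 ≤ f₁.natDegree) (Δ : Finset ℂ)
    (hΔ : ∀ x ∉ Δ, (fibre f x).Separable) (hf0 : ∀ x, fibre f x ≠ 0) {d : ℕ} (hd : 1 ≤ d)
    (hdeg : ∀ e, (lineRestriction f e).natDegree ≤ d)
    (N : Finset ℂ) (hN : ∀ a ∉ N, ∀ b, (lineRestriction f (a, b)).natDegree = d)
    {e : ℂ × ℂ} {x : Fin d → ℂ} (hx : (e, x) ∈ rootConfigurations (lineRestriction f) d)
    {i j : Fin d} (hij : i ≠ j) (hi : x i ∉ Δ) (hj : x j ∉ Δ)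
    (hi0 : f₁.evalEval (x i) (e.1 * x i + e.2) = 0)
    (hj0 : f₁.evalEval (x j) (e.1 * x j + e.2) = 0) :
    JoinedIn (rootConfigurations (lineRestriction f) d) (e, x) (e, x ∘ Equiv.swap i j) := by
  obtain ⟨e', t, k, l, hkl, hk, hl, hk0, hl0, ht⟩ :=
    exists_local_swap hdvd hirr hmon h2 Δ hΔ hf0 hd N hN
  obtain ⟨τ, rfl, rfl⟩ := exists_perm_pair hij hkl
  have hmem : ∀ {e : ℂ × ℂ} {x : Fin d → ℂ} {i j : Fin d},
      (e, x) ∈ rootConfigurations (lineRestriction f) d → i ≠ j →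
      ((x i, e.1 * x i + e.2), (x j, e.1 * x j + e.2)) ∈ chordPairs f d := by
    intro e x i j hx hij
    have hne : x i ≠ x j := fun h => hij (hx.2.1 h)
    exact ⟨hne, by simpa [eval_lineRestriction] using hx.2.2 i,
      by simpa [eval_lineRestriction] using hx.2.2 j, x, by rwa [chord_eq_of_mem hne]⟩
  have hne : x i ≠ x j := fun h => hij (hx.2.1 h)
  have hne' : t (τ i) ≠ t (τ j) := fun h => hkl (ht.source_mem.2.1 h)
  have hW := joinedIn_chordPairs_of_irreducible hdvd hirr hmon h2 Δ hΔ hd hdeg hi hi0 hj hj0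
    hk hk0 hl hl0 (hmem hx hij) (hmem ht.source_mem hkl)
  obtain ⟨x', j1, hx'i, hx'j⟩ := exists_joinedIn_of_chordPairs hdeg hW (x := x)
    (by rwa [chord_eq_of_mem hne]) hij rfl rfl
  simp only [chord_eq_of_mem hne, chord_eq_of_mem hne'] at j1 hx'i hx'j
  obtain ⟨π, rfl⟩ := exists_perm_of_rootConfigurations hdeg ht.source_mem j1.target_mem
  have hπi : π i = τ i := ht.source_mem.2.1 hx'i
  have hπj : π j = τ j := ht.source_mem.2.1 hx'j
  have j2 := joinedIn_rootConfigurations_comp ht π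
  have h3 : (t ∘ Equiv.swap (τ i) (τ j)) ∘ π = (t ∘ π) ∘ Equiv.swap i j := by
    rw [← hπi, ← hπj]
    funext m
    simp only [Function.comp_apply, π.injective.map_swap]
  rw [h3] at j2
  exact (j1.trans j2).trans (joinedIn_rootConfigurations_comp j1.symm (Equiv.swap i j))

end AffineMonodromy

section Pencils

variable {A : Type*} [CommRing A] [Algebra ℂ A]

/-- The restriction of a form to the affine line `r ↦ P + r Q`. -/
def pencil (P Q : Fin 3 → A) (G : MvPolynomial (Fin 3) ℂ) : A[X] :=
  aeval (fun i => Polynomial.C (P i) + Polynomial.X * Polynomial.C (Q i)) G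

lemma natDegree_pencil_le_and_coeff (P Q : Fin 3 → A) {G : MvPolynomial (Fin 3) ℂ} {d : ℕ}
    (hG : G.IsHomogeneous d) :
    (pencil P Q G).natDegree ≤ d ∧ (pencil P Q G).coeff d = aeval Q G := by
  have hlin : ∀ i, (Polynomial.C (P i) + Polynomial.X * Polynomial.C (Q i)).natDegree ≤ 1 :=
    fun i => by compute_degree
  have hpow : ∀ i (k : ℕ),
      ((Polynomial.C (P i) + Polynomial.X * Polynomial.C (Q i)) ^ k).natDegree ≤ k := fun i k => by
    simpa using Polynomial.natDegree_pow_le_of_le k (hlin i)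
  have hcoe : ∀ i (k : ℕ),
      ((Polynomial.C (P i) + Polynomial.X * Polynomial.C (Q i)) ^ k).coeff k = Q i ^ k :=
    fun i k => by
      have h := Polynomial.coeff_pow_of_natDegree_le (m := k) (hlin i)
      simpa using h
  have hmon : ∀ m ∈ G.support,
      (∏ i, (Polynomial.C (P i) + Polynomial.X * Polynomial.C (Q i)) ^ m i).natDegree ≤ d ∧
      (∏ i, (Polynomial.C (P i) + Polynomial.X * Polynomial.C (Q i)) ^ m i).coeff d =
        ∏ i, Q i ^ m i := by
    intro m hm
    have hd : m 0 + m 1 + m 2 = d := by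
      have h := hG (mem_support_iff.1 hm)
      rw [Finsupp.weight_apply, Finsupp.sum_fintype _ _ (by simp)] at h
      simpa [Fin.sum_univ_three] using h
    rw [Fin.prod_univ_three, Fin.prod_univ_three, ← hd]
    have h1 := Polynomial.natDegree_mul_le_of_le (hpow 0 (m 0)) (hpow 1 (m 1))
    refine ⟨Polynomial.natDegree_mul_le_of_le h1 (hpow 2 (m 2)), ?_⟩
    rw [Polynomial.coeff_mul_add_eq_of_natDegree_le h1 (hpow 2 (m 2)),
      Polynomial.coeff_mul_add_eq_of_natDegree_le (hpow 0 (m 0)) (hpow 1 (m 1)), hcoe, hcoe, hcoe]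
  have hsum : pencil P Q G = ∑ m ∈ G.support, Polynomial.C (algebraMap ℂ A (G.coeff m)) *
      ∏ i, (Polynomial.C (P i) + Polynomial.X * Polynomial.C (Q i)) ^ m i := by
    rw [pencil, aeval_def, eval₂_eq']
    rfl
  rw [hsum]
  constructor
  · refine Polynomial.natDegree_sum_le_of_forall_le _ _ fun m hm => ?_
    exact (Polynomial.natDegree_C_mul_le _ _).trans (hmon m hm).1
  · rw [Polynomial.finsetSum_coeff, aeval_def, eval₂_eq']
    refine Finset.sum_congr rfl fun m hm => ?_
    rw [Polynomial.coeff_C_mul, (hmon m hm).2]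

lemma map_pencil {B : Type*} [CommRing B] [Algebra ℂ B] (φ : A →ₐ[ℂ] B) (P Q : Fin 3 → A)
    (G : MvPolynomial (Fin 3) ℂ) :
    (pencil P Q G).map (φ : A →+* B) = pencil (fun i => φ (P i)) (fun i => φ (Q i)) G := by
  have h := DFunLike.congr_fun (comp_aeval
    (fun i => Polynomial.C (P i) + Polynomial.X * Polynomial.C (Q i)) (Polynomial.mapAlgHom φ)) G
  simpa [pencil] using h

lemma eval_pencil (u v : Fin 3 → ℂ) (G : MvPolynomial (Fin 3) ℂ) (r : ℂ) :
    (pencil u v G).eval r = eval (u + r • v) G := by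
  have h := DFunLike.congr_fun (comp_aeval
    (fun i => Polynomial.C (u i) + Polynomial.X * Polynomial.C (v i)) (Polynomial.aeval r)) G
  have h2 : (fun i => u i + v i * r) = u + r • v := by
    funext i
    simp [mul_comm]
  simpa [pencil, Polynomial.coe_aeval_eq_eval, h2] using h

lemma natDegree_pencil {u v : Fin 3 → ℂ} {G : MvPolynomial (Fin 3) ℂ} {d : ℕ}
    (hG : G.IsHomogeneous d) (hv : eval v G ≠ 0) : (pencil u v G).natDegree = d := by
  obtain ⟨h1, h2⟩ := natDegree_pencil_le_and_coeff u v hG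
  refine le_antisymm h1 (Polynomial.le_natDegree_of_ne_zero ?_)
  rw [h2]
  simpa using hv

lemma pencil_ne_zero {u v : Fin 3 → ℂ} {G : MvPolynomial (Fin 3) ℂ} {d : ℕ}
    (hG : G.IsHomogeneous d) (hv : eval v G ≠ 0) : pencil u v G ≠ 0 := by
  intro h
  have h2 := (natDegree_pencil_le_and_coeff u v hG).2
  rw [h, Polynomial.coeff_zero] at h2
  exact hv (by simpa using h2.symm)

/-- The dehomogenization of a form in the affine chart `(x, y) ↦ u + x v + y w`. -/
def chart (u v w : Fin 3 → ℂ) (G : MvPolynomial (Fin 3) ℂ) : ℂ[X][X] :=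
  pencil (fun i => Polynomial.C (u i) + Polynomial.X * Polynomial.C (v i))
    (fun i => Polynomial.C (w i)) G

lemma fibre_chart (u v w : Fin 3 → ℂ) (G : MvPolynomial (Fin 3) ℂ) (x : ℂ) :
    fibre (chart u v w G) x = pencil (u + x • v) w G := by
  have h := map_pencil (Polynomial.aeval x : ℂ[X] →ₐ[ℂ] ℂ)
    (fun i => Polynomial.C (u i) + Polynomial.X * Polynomial.C (v i))
    (fun i => Polynomial.C (w i)) G
  have h2 : (fun i => u i + v i * x) = u + x • v := by
    funext i
    simp [mul_comm]
  have h3 : ((Polynomial.aeval x : ℂ[X] →ₐ[ℂ] ℂ) : ℂ[X] →+* ℂ) = Polynomial.evalRingHom x := by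
    ext <;> simp
  rw [h3] at h
  simpa [chart, fibre, Polynomial.coe_aeval_eq_eval, h2] using h

lemma evalEval_chart (u v w : Fin 3 → ℂ) (G : MvPolynomial (Fin 3) ℂ) (x y : ℂ) :
    (chart u v w G).evalEval x y = eval (u + x • v + y • w) G := by
  rw [← eval_fibre, fibre_chart, eval_pencil]

lemma lineRestriction_chart (u v w : Fin 3 → ℂ) (G : MvPolynomial (Fin 3) ℂ) (e : ℂ × ℂ) :
    lineRestriction (chart u v w G) e = pencil (u + e.2 • w) (v + e.1 • w) G := by
  refine Polynomial.funext fun x => ?_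
  rw [eval_lineRestriction, evalEval_chart, eval_pencil]
  congr 1
  congr 1
  module

lemma evalEval_ext {p q : ℂ[X][X]} (h : ∀ x y, p.evalEval x y = q.evalEval x y) : p = q := by
  ext1 n
  refine Polynomial.funext fun x => ?_
  have h1 : fibre p x = fibre q x := Polynomial.funext fun y => by
    rw [eval_fibre, eval_fibre, h]
  simpa [fibre] using congrArg (fun r => Polynomial.coeff r n) h1

lemma chart_mul (u v w : Fin 3 → ℂ) (G H : MvPolynomial (Fin 3) ℂ) :
    chart u v w (G * H) = chart u v w G * chart u v w H := by
  simp [chart, pencil]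

lemma chart_add (u v w : Fin 3 → ℂ) (G H : MvPolynomial (Fin 3) ℂ) :
    chart u v w (G + H) = chart u v w G + chart u v w H := by
  simp [chart, pencil]

lemma chart_sub (u v w : Fin 3 → ℂ) (G H : MvPolynomial (Fin 3) ℂ) :
    chart u v w (G - H) = chart u v w G - chart u v w H := by
  simp [chart, pencil]

lemma chart_pow (u v w : Fin 3 → ℂ) (G : MvPolynomial (Fin 3) ℂ) (n : ℕ) :
    chart u v w (G ^ n) = chart u v w G ^ n := by
  simp [chart, pencil]

/-- The linear form with given coefficients, as a polynomial. -/
def linearForm (l : (Fin 3 → ℂ) →ₗ[ℂ] ℂ) : MvPolynomial (Fin 3) ℂ :=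
  ∑ i, C (l (Pi.single i 1)) * X i

lemma eval_linearForm (l : (Fin 3 → ℂ) →ₗ[ℂ] ℂ) (z : Fin 3 → ℂ) : eval z (linearForm l) = l z := by
  rw [LinearMap.pi_apply_eq_sum_univ l z]
  simp only [linearForm, map_sum, map_mul, eval_C, eval_X, smul_eq_mul]
  refine Finset.sum_congr rfl fun i _ => ?_
  rw [mul_comm]
  congr 2
  funext j
  simp [Pi.single_apply, eq_comm]

lemma isHomogeneous_linearForm (l : (Fin 3 → ℂ) →ₗ[ℂ] ℂ) : (linearForm l).IsHomogeneous 1 :=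
  IsHomogeneous.sum _ _ _ fun i _ => isHomogeneous_C_mul_X _ i

end Pencils

section Irreducibility

variable (b : Module.Basis (Fin 3) ℂ (Fin 3 → ℂ))

lemma chart_linearForm_coord (k : Fin 3) (x y : ℂ) :
    (chart (b 0) (b 1) (b 2) (linearForm (b.coord k))).evalEval x y =
      b.coord k (b 0) + x * b.coord k (b 1) + y * b.coord k (b 2) := by
  rw [evalEval_chart, eval_linearForm]
  simp only [map_add, map_smul, smul_eq_mul]

lemma chart_coord_zero : chart (b 0) (b 1) (b 2) (linearForm (b.coord 0)) = 1 :=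
  evalEval_ext fun x y => by
    rw [chart_linearForm_coord]
    simp [Polynomial.evalEval]

lemma chart_coord_one :
    chart (b 0) (b 1) (b 2) (linearForm (b.coord 1)) = Polynomial.C Polynomial.X :=
  evalEval_ext fun x y => by
    rw [chart_linearForm_coord]
    simp [Polynomial.evalEval]

lemma chart_coord_two : chart (b 0) (b 1) (b 2) (linearForm (b.coord 2)) = Polynomial.X :=
  evalEval_ext fun x y => by
    rw [chart_linearForm_coord]
    simp [Polynomial.evalEval]

lemma eval_smul_of_isHomogeneous {G : MvPolynomial (Fin 3) ℂ} {k : ℕ} (hG : G.IsHomogeneous k)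
    (c : ℂ) (z : Fin 3 → ℂ) : eval (c • z) G = c ^ k * eval z G := by
  rw [eval_eq', eval_eq', Finset.mul_sum]
  refine Finset.sum_congr rfl fun m hm => ?_
  have h := hG (mem_support_iff.1 hm)
  rw [Finsupp.weight_apply, Finsupp.sum_fintype _ _ (by simp)] at h
  have h2 : ∑ i, m i = k := by simpa using h
  simp only [Pi.smul_apply, smul_eq_mul, mul_pow, Finset.prod_mul_distrib,
    Finset.prod_pow_eq_pow_sum, h2]
  ring

lemma eq_zero_of_chart_eq_zero {G : MvPolynomial (Fin 3) ℂ} {k : ℕ} (hG : G.IsHomogeneous k)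
    (h : chart (b 0) (b 1) (b 2) G = 0) : G = 0 := by
  have hl : linearForm (b.coord 0) ≠ 0 := by
    intro h0
    have h1 := chart_coord_zero b
    simp [h0, chart, pencil] at h1
  refine (mul_eq_zero.1 (?_ : linearForm (b.coord 0) * G = 0)).resolve_left hl
  refine MvPolynomial.funext fun z => ?_
  rw [map_mul, eval_linearForm, map_zero]
  by_cases hz : b.coord 0 z = 0
  · rw [hz, zero_mul]
  have hexp : z = b.coord 0 z • (b 0 + (b.coord 1 z / b.coord 0 z) • b 1 +
      (b.coord 2 z / b.coord 0 z) • b 2) := by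
    conv_lhs => rw [← b.sum_repr z, Fin.sum_univ_three]
    simp only [smul_add, smul_smul, mul_div_cancel₀ _ hz,
      ← Module.Basis.coord_apply]
  rw [hexp, eval_smul_of_isHomogeneous hG, ← evalEval_chart, h]
  simp

lemma exists_isHomogeneous_chart_eq (P : ℂ[X][X]) :
    ∃ (k : ℕ) (G : MvPolynomial (Fin 3) ℂ), G.IsHomogeneous k ∧ chart (b 0) (b 1) (b 2) G = P := by
  have hadd : ∀ P Q : ℂ[X][X],
      (∃ (k : ℕ) (G : MvPolynomial (Fin 3) ℂ), G.IsHomogeneous k ∧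
        chart (b 0) (b 1) (b 2) G = P) →
      (∃ (k : ℕ) (G : MvPolynomial (Fin 3) ℂ), G.IsHomogeneous k ∧
        chart (b 0) (b 1) (b 2) G = Q) →
      ∃ (k : ℕ) (G : MvPolynomial (Fin 3) ℂ), G.IsHomogeneous k ∧
        chart (b 0) (b 1) (b 2) G = P + Q := by
    rintro _ _ ⟨k, G, hG, rfl⟩ ⟨l, H, hH, rfl⟩
    have h0 := isHomogeneous_linearForm (b.coord 0)
    refine ⟨l + k, linearForm (b.coord 0) ^ l * G + linearForm (b.coord 0) ^ k * H, ?_, ?_⟩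
    · have h1 := (h0.pow l).mul hG
      have h2 := (h0.pow k).mul hH
      rw [one_mul] at h1 h2
      rw [add_comm k l] at h2
      exact h1.add h2
    · simp [chart_add, chart_mul, chart_pow, chart_coord_zero]
  have hmul : ∀ P Q : ℂ[X][X],
      (∃ (k : ℕ) (G : MvPolynomial (Fin 3) ℂ), G.IsHomogeneous k ∧
        chart (b 0) (b 1) (b 2) G = P) →
      (∃ (k : ℕ) (G : MvPolynomial (Fin 3) ℂ), G.IsHomogeneous k ∧
        chart (b 0) (b 1) (b 2) G = Q) →
      ∃ (k : ℕ) (G : MvPolynomial (Fin 3) ℂ), G.IsHomogeneous k ∧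
        chart (b 0) (b 1) (b 2) G = P * Q := by
    rintro _ _ ⟨k, G, hG, rfl⟩ ⟨l, H, hH, rfl⟩
    exact ⟨k + l, G * H, hG.mul hH, chart_mul _ _ _ _ _⟩
  induction P using Polynomial.induction_on with
  | C a =>
    induction a using Polynomial.induction_on with
    | C c => exact ⟨0, C c, isHomogeneous_C _ _, by simp [chart, pencil]⟩
    | add p q hp hq =>
      rw [map_add]
      exact hadd _ _ hp hq
    | monomial n c h =>
      rw [pow_succ, ← mul_assoc, map_mul]
      exact hmul _ _ h ⟨1, _, isHomogeneous_linearForm _, chart_coord_one b⟩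
  | add p q hp hq => exact hadd _ _ hp hq
  | monomial n a h =>
    rw [pow_succ, ← mul_assoc]
    exact hmul _ _ h ⟨1, _, isHomogeneous_linearForm _, chart_coord_two b⟩

lemma prime_chart {G : MvPolynomial (Fin 3) ℂ} {k : ℕ} (hG : G.IsHomogeneous k)
    (hirr : Irreducible G) (hu : ¬ IsUnit (chart (b 0) (b 1) (b 2) G)) :
    Prime (chart (b 0) (b 1) (b 2) G) := by
  refine ⟨fun h => hirr.ne_zero (eq_zero_of_chart_eq_zero b hG h), hu, ?_⟩
  rintro P Q ⟨R, hR⟩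
  obtain ⟨p, P, hP, rfl⟩ := exists_isHomogeneous_chart_eq b P
  obtain ⟨q, Q, hQ, rfl⟩ := exists_isHomogeneous_chart_eq b Q
  obtain ⟨r, R, hR', rfl⟩ := exists_isHomogeneous_chart_eq b R
  have h0 := isHomogeneous_linearForm (b.coord 0)
  have h1 := (h0.pow (k + r)).mul (hP.mul hQ)
  have h2 := (h0.pow (p + q)).mul (hG.mul hR')
  rw [one_mul] at h1 h2
  rw [add_comm (p + q)] at h2
  have h3 := eq_zero_of_chart_eq_zero b (h1.sub h2)
    (by simp [chart_sub, chart_mul, chart_pow, chart_coord_zero, hR])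
  have hdvd : G ∣ linearForm (b.coord 0) ^ (k + r) * (P * Q) :=
    ⟨linearForm (b.coord 0) ^ (p + q) * R, by linear_combination h3⟩
  have hchart : ∀ H, G ∣ H → chart (b 0) (b 1) (b 2) G ∣ chart (b 0) (b 1) (b 2) H := by
    rintro _ ⟨K, rfl⟩
    exact ⟨_, chart_mul _ _ _ _ _⟩
  rcases hirr.prime.dvd_or_dvd hdvd with h | h
  · have h4 := hchart _ (hirr.prime.dvd_of_dvd_pow h)
    rw [chart_coord_zero] at h4
    exact absurd (isUnit_of_dvd_one h4) hu
  · exact (hirr.prime.dvd_or_dvd h).imp (hchart _) (hchart _)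

end Irreducibility

section ProjectiveLines

open scoped Matrix

lemma mk_mem_curveSet_iff {G : MvPolynomial (Fin 3) ℂ} {k : ℕ} (hG : G.IsHomogeneous k)
    {z : Fin 3 → ℂ} (hz : z ≠ 0) :
    (Projectivization.mk ℂ z hz : P2) ∈ curveSet G ↔ eval z G = 0 := by
  obtain ⟨a, ha⟩ := Projectivization.exists_smul_eq_mk_rep ℂ z hz
  rw [curveSet, Set.mem_ofPred_eq, ← ha, Units.smul_def, eval_smul_of_isHomogeneous hG]
  simp

lemma mk_mem_lineSet_mk_iff {ξ z : Fin 3 → ℂ} (hξ : ξ ≠ 0) (hz : z ≠ 0) :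
    (Projectivization.mk ℂ z hz : P2) ∈ lineSet (Projectivization.mk ℂ ξ hξ) ↔ ξ ⬝ᵥ z = 0 := by
  obtain ⟨a, ha⟩ := Projectivization.exists_smul_eq_mk_rep ℂ z hz
  obtain ⟨b, hb⟩ := Projectivization.exists_smul_eq_mk_rep ℂ ξ hξ
  rw [lineSet, Set.mem_ofPred_eq, ← ha, ← hb]
  change (b • ξ) ⬝ᵥ (a • z) = 0 ↔ _
  simp [Units.smul_def]

lemma continuous_mk {X : Type*} [TopologicalSpace X] {g : X → Fin 3 → ℂ} (hg : Continuous g)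
    (h : ∀ x, g x ≠ 0) : Continuous fun x => (Projectivization.mk ℂ (g x) (h x) : P2) :=
  (continuous_quotient_mk' (s := projectivizationSetoid ℂ (Fin 3 → ℂ))).comp
    (Continuous.subtype_mk hg h)

variable {u v : Fin 3 → ℂ}

lemma add_smul_ne_zero (h : LinearIndependent ℂ ![u, v]) (x : ℂ) : u + x • v ≠ 0 := fun h0 =>
  one_ne_zero (LinearIndependent.pair_iff.1 h 1 x (by rwa [one_smul])).1

lemma crossProduct_eq_smul {ξ : Fin 3 → ℂ} (hξ : ξ ≠ 0)
    (hu : ξ ⬝ᵥ u = 0) (hv : ξ ⬝ᵥ v = 0) : ∃ c : ℂ, c • ξ = u ⨯₃ v := by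
  have h1 : ¬ LinearIndependent ℂ ![ξ, u ⨯₃ v] := by
    rw [← crossProduct_ne_zero_iff_linearIndependent, not_not, cross_cross_eq_smul_sub_smul', hv,
      dotProduct_comm, hu]
    simp
  rw [LinearIndependent.pair_iff' hξ] at h1
  push Not at h1
  exact h1

lemma mk_crossProduct_eq (h : LinearIndependent ℂ ![u, v]) {ξ : Fin 3 → ℂ} (hξ : ξ ≠ 0)
    (hu : ξ ⬝ᵥ u = 0) (hv : ξ ⬝ᵥ v = 0) :
    Projectivization.mk ℂ (u ⨯₃ v) (crossProduct_ne_zero_iff_linearIndependent.2 h) =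
      Projectivization.mk ℂ ξ hξ :=
  (Projectivization.mk_eq_mk_iff' ℂ _ _ _ _).2 (crossProduct_eq_smul hξ hu hv)

lemma exists_eq_of_dotProduct_eq_zero (h : LinearIndependent ℂ ![u, v]) {ξ z : Fin 3 → ℂ}
    (hξ : ξ ≠ 0) (hu : ξ ⬝ᵥ u = 0) (hv : ξ ⬝ᵥ v = 0) (hz : ξ ⬝ᵥ z = 0) :
    ∃ α β : ℂ, α • u + β • v = z := by
  obtain ⟨c, hc⟩ := crossProduct_eq_smul hξ hu hv
  have h1 : Matrix.det ![z, u, v] = 0 := by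
    rw [← triple_product_eq_det, ← hc, dotProduct_smul, dotProduct_comm, hz, smul_zero]
  have h2 : ¬ LinearIndependent ℂ ![z, u, v] := fun h3 => by
    have h4 := (Matrix.isUnit_iff_isUnit_det _).1 (Matrix.linearIndependent_rows_iff_isUnit.1
      (show LinearIndependent ℂ (Matrix.row (![z, u, v] : Matrix (Fin 3) (Fin 3) ℂ)) from h3))
    exact h4.ne_zero h1
  have h3 := mt (fun h3 => linearIndependent_finCons.2 ⟨h, h3⟩) h2
  rw [not_not, Matrix.range_cons, Matrix.range_cons, Matrix.range_empty, Set.union_empty,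
    Set.singleton_union] at h3
  exact Submodule.mem_span_pair.1 h3

/-- The affine parametrization of the projective line through `u` and `v` that misses `v`. -/
def linePoint (h : LinearIndependent ℂ ![u, v]) (x : ℂ) : P2 :=
  Projectivization.mk ℂ (u + x • v) (add_smul_ne_zero h x)

lemma linePoint_injective (h : LinearIndependent ℂ ![u, v]) :
    Function.Injective (linePoint h) := by
  intro x y hxy
  obtain ⟨a, ha⟩ := (Projectivization.mk_eq_mk_iff' ℂ _ _ _ _).1 hxy
  have h1 := LinearIndependent.pair_iff.1 h (a - 1) (a * y - x) (by
    rw [← sub_eq_zero] at ha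
    rw [← ha]
    module)
  have h2 : a = 1 := sub_eq_zero.1 h1.1
  have h3 := h1.2
  rw [h2, one_mul, sub_eq_zero] at h3
  exact h3.symm

/-- A line meeting the plane curve `F = 0` away from `v`, described through `linePoint`. -/
lemma curveSet_inter_lineSet_mk (h : LinearIndependent ℂ ![u, v]) {F : MvPolynomial (Fin 3) ℂ}
    {d : ℕ} (hF : F.IsHomogeneous d) (hFv : eval v F ≠ 0) {ξ : Fin 3 → ℂ} (hξ : ξ ≠ 0)
    (hu : ξ ⬝ᵥ u = 0) (hv : ξ ⬝ᵥ v = 0) :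
    curveSet F ∩ lineSet (Projectivization.mk ℂ ξ hξ) =
      linePoint h '' {x | eval (u + x • v) F = 0} := by
  ext P
  constructor
  · induction P using Projectivization.ind with
    | h z hz =>
    rintro ⟨h1, h2⟩
    rw [mk_mem_curveSet_iff hF] at h1
    rw [mk_mem_lineSet_mk_iff] at h2
    obtain ⟨α, β, rfl⟩ := exists_eq_of_dotProduct_eq_zero h hξ hu hv h2
    have hα : α ≠ 0 := by
      rintro rfl
      rw [zero_smul, zero_add, eval_smul_of_isHomogeneous hF] at h1
      rcases mul_eq_zero.1 h1 with h3 | h3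
      · exact hz (by simp [eq_zero_of_pow_eq_zero h3])
      · exact hFv h3
    have h3 : α • u + β • v = α • (u + (β / α) • v) := by
      rw [smul_add, smul_smul, mul_div_cancel₀ _ hα]
    refine ⟨β / α, ?_, ?_⟩
    · rw [h3, eval_smul_of_isHomogeneous hF] at h1
      exact (mul_eq_zero.1 h1).resolve_left (pow_ne_zero _ hα)
    · refine (Projectivization.mk_eq_mk_iff' ℂ _ _ _ _).2 ⟨α⁻¹, ?_⟩
      rw [h3, smul_smul, inv_mul_cancel₀ hα, one_smul]
  · rintro ⟨x, hx, rfl⟩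
    refine ⟨(mk_mem_curveSet_iff hF _).2 hx, (mk_mem_lineSet_mk_iff hξ _).2 ?_⟩
    rw [dotProduct_add, dotProduct_smul, hu, hv]
    simp

lemma curveSet_inter_lineSet_eq_range (h : LinearIndependent ℂ ![u, v])
    {F : MvPolynomial (Fin 3) ℂ} {d : ℕ} (hF : F.IsHomogeneous d) (hFv : eval v F ≠ 0)
    {ξ : Fin 3 → ℂ} (hξ : ξ ≠ 0) (hu : ξ ⬝ᵥ u = 0) (hv : ξ ⬝ᵥ v = 0) {x : Fin d → ℂ}
    (hx : Function.Injective x) (hr : ∀ i, (pencil u v F).eval (x i) = 0) :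
    curveSet F ∩ lineSet (Projectivization.mk ℂ ξ hξ) = Set.range fun i => linePoint h (x i) := by
  rw [curveSet_inter_lineSet_mk h hF hFv hξ hu hv, ← Function.comp_def, Set.range_comp]
  congr 1
  ext z
  simp only [eval_pencil, Set.mem_ofPred_eq, Set.mem_range] at hr ⊢
  refine ⟨fun hz => exists_eq_of_root (pencil_ne_zero hF hFv) (natDegree_pencil hF hFv).le hx
    (fun i => (eval_pencil ..).trans (hr i)) ((eval_pencil ..).trans hz), ?_⟩
  rintro ⟨i, rfl⟩
  exact hr i

lemma exists_injective_roots_of_ncard {p : ℂ[X]} {d : ℕ} (hd : 1 ≤ d)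
    (h : {x | p.eval x = 0}.ncard = d) :
    ∃ x : Fin d → ℂ, Function.Injective x ∧ ∀ i, p.eval (x i) = 0 := by
  have hfin : {x | p.eval x = 0}.Finite := Set.finite_of_ncard_ne_zero (by omega)
  rw [Set.ncard_eq_toFinset_card _ hfin] at h
  let e := hfin.toFinset.equivFinOfCardEq h
  refine ⟨fun i => (e.symm i : ℂ), fun i j hij => e.symm.injective (Subtype.ext hij), fun i => ?_⟩
  exact hfin.mem_toFinset.1 (e.symm i).2

end ProjectiveLines

section ProjectiveMonodromy

lemma exists_pencil_separability_witness (z v n : Fin 3 → ℂ) {F : MvPolynomial (Fin 3) ℂ} {d : ℕ}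
    (hd : 1 ≤ d) (hF : F.IsHomogeneous d) :
    ∃ δ : ℂ[X], ∀ s, δ.eval s ≠ 0 ↔
      (pencil z (v + s • n) F).natDegree = d ∧ (pencil z (v + s • n) F).Separable := by
  obtain ⟨δ, hδ⟩ := exists_separability_witness
    (pencil (fun i => Polynomial.C (z i))
      (fun i => Polynomial.C (v i) + Polynomial.X * Polynomial.C (n i)) F) d hd
    (natDegree_pencil_le_and_coeff _ _ hF).1
  refine ⟨δ, fun s => ?_⟩
  have h := map_pencil (Polynomial.aeval s : ℂ[X] →ₐ[ℂ] ℂ) (fun i => Polynomial.C (z i))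
    (fun i => Polynomial.C (v i) + Polynomial.X * Polynomial.C (n i)) F
  have h2 : (fun i => v i + n i * s) = v + s • n := by
    funext i
    simp [mul_comm]
  have h3 : (pencil (fun i => Polynomial.C (z i))
      (fun i => Polynomial.C (v i) + Polynomial.X * Polynomial.C (n i)) F).map
        (Polynomial.evalRingHom s) = pencil z (v + s • n) F := by
    have h4 : ((Polynomial.aeval s : ℂ[X] →ₐ[ℂ] ℂ) : ℂ[X] →+* ℂ) = Polynomial.evalRingHom s := by
      ext <;> simp
    rw [h4] at h
    simpa [Polynomial.coe_aeval_eq_eval, h2] using h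
  rw [← h3]
  exact hδ (Polynomial.evalRingHom s)

lemma eval_ne_zero_of_le_natDegree {u v : Fin 3 → ℂ} {G : MvPolynomial (Fin 3) ℂ} {d : ℕ}
    (hG : G.IsHomogeneous d) (h0 : pencil u v G ≠ 0) (hd : d ≤ (pencil u v G).natDegree) :
    eval v G ≠ 0 := by
  obtain ⟨h1, h2⟩ := natDegree_pencil_le_and_coeff u v hG
  rw [le_antisymm hd h1, Polynomial.coeff_natDegree] at h2
  intro h3
  refine Polynomial.leadingCoeff_ne_zero.2 h0 (h2.trans ?_)
  simpa using h3

lemma exists_transversal_direction {u v : Fin 3 → ℂ} (h : LinearIndependent ℂ ![u, v])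
    {F : MvPolynomial (Fin 3) ℂ} {d : ℕ} (hd : 1 ≤ d) (hF : F.IsHomogeneous d)
    (hFv : eval v F ≠ 0) {x : Fin d → ℂ} (hx : Function.Injective x)
    (hr : ∀ i, (pencil u v F).eval (x i) = 0) {S : Finset ℂ} (hS : S.Nonempty) :
    ∃ b : Module.Basis (Fin 3) ℂ (Fin 3 → ℂ), b 0 = u ∧ b 1 = v ∧ eval (b 2) F ≠ 0 ∧
      ∀ c ∈ S, (pencil (u + c • v) (b 2) F).natDegree = d ∧
        (pencil (u + c • v) (b 2) F).Separable := by
  obtain ⟨n, hn⟩ : ∃ n, n ∉ Submodule.span ℂ (Set.range ![u, v]) := by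
    by_contra! hn
    have h1 := finrank_span_eq_card h
    rw [Submodule.eq_top_iff'.2 hn] at h1
    simp at h1
  choose δ hδ using fun c : ℂ => exists_pencil_separability_witness (u + c • v) v n hd hF
  have h0 : ∀ c, δ c ≠ 0 := fun c h0 => by
    refine (hδ c 0).2 ?_ (by simp [h0])
    rw [zero_smul, add_zero]
    refine ⟨natDegree_pencil hF hFv, separable_of_injective_roots (x := fun i => x i - c)
      (pencil_ne_zero hF hFv) (natDegree_pencil hF hFv).le
      (fun i j hij => hx (sub_left_injective hij)) fun i => ?_⟩
    rw [eval_pencil, ← hr i, eval_pencil]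
    congr 1
    congr 1
    module
  obtain ⟨s, hs⟩ : ∃ s, (Polynomial.X * ∏ c ∈ S, δ c).eval s ≠ 0 := by
    by_contra! h1
    have h2 : Polynomial.X * ∏ c ∈ S, δ c = 0 :=
      Polynomial.funext fun s => by rw [h1, Polynomial.eval_zero]
    exact mul_ne_zero Polynomial.X_ne_zero (Finset.prod_ne_zero_iff.2 fun c _ => h0 c) h2
  rw [Polynomial.eval_mul, Polynomial.eval_X, Polynomial.eval_prod, mul_ne_zero_iff,
    Finset.prod_ne_zero_iff] at hs
  have hw : v + s • n ∉ Submodule.span ℂ (Set.range ![u, v]) := fun h1 => by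
    have hv : v ∈ Submodule.span ℂ (Set.range ![u, v]) := Submodule.subset_span ⟨1, rfl⟩
    have h2 := (Submodule.add_mem_iff_right _ hv).1 h1
    exact hn ((Submodule.smul_mem_iff _ hs.1).1 h2)
  have hli : LinearIndependent ℂ ![u, v, v + s • n] := by
    have h1 : LinearIndependent ℂ ![v + s • n, u, v] := linearIndependent_finCons.2 ⟨h, hw⟩
    have h2 := h1.comp ![1, 2, 0] (by decide)
    convert h2 using 1
    funext k
    fin_cases k <;> rfl
  let b := basisOfLinearIndependentOfCardEqFinrank hli (by simp)
  have hb : ⇑b = ![u, v, v + s • n] := coe_basisOfLinearIndependentOfCardEqFinrank _ _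
  have hS' : ∀ c ∈ S, (pencil (u + c • v) (b 2) F).natDegree = d ∧
      (pencil (u + c • v) (b 2) F).Separable := fun c hc => by
    rw [hb]
    exact (hδ c s).1 (hs.2 c hc)
  obtain ⟨c, hc⟩ := hS
  refine ⟨b, by rw [hb]; rfl, by rw [hb]; rfl, ?_, hS'⟩
  exact eval_ne_zero_of_le_natDegree hF (hS' c hc).2.ne_zero (hS' c hc).1.ge

lemma exists_monic_irreducible_factor_chart (b : Module.Basis (Fin 3) ℂ (Fin 3 → ℂ))
    {F F₁ : MvPolynomial (Fin 3) ℂ} {d₁ : ℕ} (hirr : Irreducible F₁) (hdvd : F₁ ∣ F)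
    (hF₁ : F₁.IsHomogeneous d₁) (hd₁ : 1 ≤ d₁) (hw : eval (b 2) F₁ ≠ 0) :
    ∃ f₁ : ℂ[X][X], f₁ ∣ chart (b 0) (b 1) (b 2) F ∧ Irreducible f₁ ∧ f₁.Monic ∧
      f₁.natDegree = d₁ ∧
      ∀ x y, eval (b 0 + x • b 1 + y • b 2) F₁ = 0 → f₁.evalEval x y = 0 := by
  obtain ⟨h1, h2⟩ := natDegree_pencil_le_and_coeff
    (fun i => Polynomial.C (b 0 i) + Polynomial.X * Polynomial.C (b 1 i))
    (fun i => (Polynomial.C (b 2 i) : ℂ[X])) hF₁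
  change (chart (b 0) (b 1) (b 2) F₁).natDegree ≤ d₁ at h1
  have h3 : (chart (b 0) (b 1) (b 2) F₁).coeff d₁ = Polynomial.C (eval (b 2) F₁) := by
    refine h2.trans ?_
    have h4 := DFunLike.congr_fun (comp_aeval (b 2) (Algebra.ofId ℂ ℂ[X])) F₁
    simpa [Algebra.ofId_apply, Polynomial.algebraMap_eq] using h4.symm
  have h4 : (chart (b 0) (b 1) (b 2) F₁).natDegree = d₁ :=
    le_antisymm h1 (Polynomial.le_natDegree_of_ne_zero (by rwa [h3, Polynomial.C_ne_zero]))
  have hu : IsUnit (Polynomial.C (Polynomial.C (eval (b 2) F₁)⁻¹) : ℂ[X][X]) :=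
    Polynomial.isUnit_C.2 (Polynomial.isUnit_C.2 (inv_ne_zero hw).isUnit)
  have hprime := prime_chart b hF₁ hirr (fun h => by
    have h5 := Polynomial.natDegree_eq_zero_of_isUnit h
    omega)
  refine ⟨Polynomial.C (Polynomial.C (eval (b 2) F₁)⁻¹) * chart (b 0) (b 1) (b 2) F₁,
    ?_, ?_, ?_, ?_, fun x y hxy => ?_⟩
  · obtain ⟨K, rfl⟩ := hdvd
    rw [hu.mul_left_dvd, chart_mul]
    exact dvd_mul_right _ _
  · exact (irreducible_isUnit_mul hu).2 hprime.irreducible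
  · rw [Polynomial.Monic, Polynomial.leadingCoeff_mul, Polynomial.leadingCoeff_C,
      Polynomial.leadingCoeff, h4, h3, ← Polynomial.C_mul, inv_mul_cancel₀ hw, Polynomial.C_1]
  · rw [Polynomial.natDegree_C_mul (Polynomial.C_ne_zero.2 (inv_ne_zero hw)), h4]
  · rw [Polynomial.evalEval_mul, evalEval_chart, hxy, mul_zero]

lemma joinedIn_rootConfigurations_pencil_swap (b : Module.Basis (Fin 3) ℂ (Fin 3 → ℂ))
    {F F₁ : MvPolynomial (Fin 3) ℂ} {d d₁ : ℕ} (hd : 1 ≤ d) (hF : F.IsHomogeneous d)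
    (hirr : Irreducible F₁) (hdvd : F₁ ∣ F) (hF₁ : F₁.IsHomogeneous d₁) (hd₁ : 2 ≤ d₁)
    (hv : eval (b 1) F ≠ 0) (hw : eval (b 2) F ≠ 0)
    {x : Fin d → ℂ} (hx : Function.Injective x)
    (hr : ∀ i, (pencil (b 0) (b 1) F).eval (x i) = 0) {i j : Fin d} (hij : i ≠ j)
    (hs : ∀ c ∈ ({x i, x j} : Finset ℂ), (pencil (b 0 + c • b 1) (b 2) F).Separable)
    (hi : eval (b 0 + x i • b 1) F₁ = 0) (hj : eval (b 0 + x j • b 1) F₁ = 0) :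
    JoinedIn (rootConfigurations
      (fun e : ℂ × ℂ => pencil (b 0 + e.2 • b 2) (b 1 + e.1 • b 2) F) d)
      (0, x) (0, x ∘ Equiv.swap i j) := by
  have hw₁ : eval (b 2) F₁ ≠ 0 := fun h => by
    obtain ⟨K, rfl⟩ := hdvd
    exact hw (by rw [map_mul, h, zero_mul])
  obtain ⟨f₁, h1, h2, h3, h4, h5⟩ :=
    exists_monic_irreducible_factor_chart b hirr hdvd hF₁ (by omega) hw₁
  set f := chart (b 0) (b 1) (b 2) F with hf
  have hline : lineRestriction f =
      fun e : ℂ × ℂ => pencil (b 0 + e.2 • b 2) (b 1 + e.1 • b 2) F :=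
    funext fun e => lineRestriction_chart _ _ _ _ e
  obtain ⟨D, hD⟩ := exists_separability_witness f d hd (natDegree_pencil_le_and_coeff _ _ hF).1
  have hfib : ∀ c, D.eval c ≠ 0 ↔ (pencil (b 0 + c • b 1) (b 2) F).Separable := fun c => by
    have h6 := hD (Polynomial.evalRingHom c)
    have h7 : f.map (Polynomial.evalRingHom c) = pencil (b 0 + c • b 1) (b 2) F :=
      fibre_chart _ _ _ _ c
    rw [h7] at h6
    exact h6.trans (and_iff_right (natDegree_pencil hF hw))
  have hD0 : D ≠ 0 := by
    rintro rfl
    exact (hfib (x i)).2 (hs _ (by simp)) (by simp)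
  have hΔ : ∀ c, c ∉ D.roots.toFinset ↔ (pencil (b 0 + c • b 1) (b 2) F).Separable := fun c => by
    rw [← hfib]
    simp [hD0]
  rw [← hline]
  have hp0 := pencil_ne_zero hF hv (u := b 1)
  refine joinedIn_rootConfigurations_swap h1 h2 h3 (h4 ▸ hd₁) D.roots.toFinset
    (fun c hc => ?_) (fun c => ?_) hd (fun e => ?_) (pencil (b 1) (b 2) F).roots.toFinset
    (fun a ha c => ?_) ?_ hij ((hΔ _).2 (hs _ (by simp))) ((hΔ _).2 (hs _ (by simp)))
    (h5 _ _ ?_) (h5 _ _ ?_)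
  · rw [fibre_chart]
    exact (hΔ c).1 hc
  · rw [fibre_chart]
    exact pencil_ne_zero hF hw
  · rw [lineRestriction_chart]
    exact (natDegree_pencil_le_and_coeff _ _ hF).1
  · rw [lineRestriction_chart]
    refine natDegree_pencil hF fun h6 => ha ?_
    rw [Multiset.mem_toFinset, Polynomial.mem_roots (pencil_ne_zero hF hw), Polynomial.IsRoot,
      eval_pencil, h6]
  · rw [hline]
    refine ⟨?_, hx, fun k => ?_⟩
    · simpa using pencil_ne_zero hF hv
    · simpa using hr k
  · simpa using hi
  · simpa using hj

lemma linearIndependent_add_smul (b : Module.Basis (Fin 3) ℂ (Fin 3 → ℂ)) (e : ℂ × ℂ) :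
    LinearIndependent ℂ ![b 0 + e.2 • b 2, b 1 + e.1 • b 2] := by
  rw [LinearIndependent.pair_iff]
  intro s t h
  have h1 : s • b 0 + t • b 1 + (s * e.2 + t * e.1) • b 2 = 0 := by
    rw [← h]
    module
  have h2 := Fintype.linearIndependent_iff.1 b.linearIndependent ![s, t, s * e.2 + t * e.1]
    (by simpa [Fin.sum_univ_three] using h1)
  exact ⟨h2 0, h2 1⟩

end ProjectiveMonodromy

section Loop

open scoped Matrix

lemma exists_loop_of_joinedIn (b : Module.Basis (Fin 3) ℂ (Fin 3 → ℂ))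
    (h : LinearIndependent ℂ ![b 0, b 1]) {F : MvPolynomial (Fin 3) ℂ} {d : ℕ}
    (hF : F.IsHomogeneous d) {x y : Fin d → ℂ}
    (hxy : JoinedIn (rootConfigurations
      (fun e : ℂ × ℂ => pencil (b 0 + e.2 • b 2) (b 1 + e.1 • b 2) F) d) (0, x) (0, y)) :
    ∃ γ : unitInterval → P2, Continuous γ ∧ (∀ t, γ t ∈ transversalLines F d) ∧
      γ 0 = Projectivization.mk ℂ _ (crossProduct_ne_zero_iff_linearIndependent.2 h) ∧
      γ 1 = Projectivization.mk ℂ _ (crossProduct_ne_zero_iff_linearIndependent.2 h) ∧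
      ∃ φ : Fin d → unitInterval → P2,
        (∀ k, Continuous (φ k) ∧ ∀ t, φ k t ∈ curveSet F ∩ lineSet (γ t)) ∧
        (∀ t, Function.Injective fun k => φ k t) ∧
        (∀ k, φ k 0 = linePoint h (x k)) ∧ ∀ k, φ k 1 = linePoint h (y k) := by
  obtain ⟨p, hp⟩ := hxy
  have hli := fun t => linearIndependent_add_smul b (p t).1
  have hinj : ∀ t, Function.Injective (p t).2 := fun t => (hp t).2.1
  have hv : ∀ t, eval (b 1 + (p t).1.1 • b 2) F ≠ 0 := fun t =>
    eval_ne_zero_of_le_natDegree hF (hp t).1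
      (natDegree_le_card_of_roots (hp t).1 (hinj t) (hp t).2.2)
  have hrange : ∀ t, curveSet F ∩ lineSet (Projectivization.mk ℂ _
      (crossProduct_ne_zero_iff_linearIndependent.2 (hli t))) =
        Set.range fun k => linePoint (hli t) ((p t).2 k) := fun t =>
    curveSet_inter_lineSet_eq_range (hli t) hF (hv t) _
      (by rw [dotProduct_comm, dot_self_cross]) (by rw [dotProduct_comm, dot_cross_self])
      (hinj t) (hp t).2.2
  have hc1 : Continuous fun t => b 0 + (p t).1.2 • b 2 := by fun_prop
  have hc2 : Continuous fun t => b 1 + (p t).1.1 • b 2 := by fun_prop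
  have hinj' : ∀ t, Function.Injective fun k => linePoint (hli t) ((p t).2 k) := fun t =>
    (linePoint_injective (hli t)).comp (hinj t)
  refine ⟨fun t => Projectivization.mk ℂ _
    (crossProduct_ne_zero_iff_linearIndependent.2 (hli t)), continuous_mk ?_ _, fun t => ?_, ?_, ?_,
    fun k t => linePoint (hli t) ((p t).2 k), fun k => ⟨continuous_mk ?_ _, fun t => ?_⟩,
    hinj', fun k => ?_, fun k => ?_⟩
  · simp only [cross_apply]
    fun_prop
  · rw [transversalLines, Set.mem_ofPred_eq, hrange, Set.ncard_range_of_injective (hinj' t)]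
    simp
  · exact (Projectivization.mk_eq_mk_iff' ℂ _ _ _ _).2 ⟨1, by simp⟩
  · exact (Projectivization.mk_eq_mk_iff' ℂ _ _ _ _).2 ⟨1, by simp⟩
  · fun_prop
  · rw [hrange]
    exact ⟨k, rfl⟩
  · exact (Projectivization.mk_eq_mk_iff' ℂ _ _ _ _).2 ⟨1, by simp⟩
  · exact (Projectivization.mk_eq_mk_iff' ℂ _ _ _ _).2 ⟨1, by simp⟩

end Loop

end PlaneCurve

open PlaneCurve

/-- **Corollary 1 of the paper.**  Let `C = {F = 0}` be a reduced plane
curve of degree `d ≥ 1` and `C₁ = {F₁ = 0}` an irreducible component of `C` of degree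
`d₁ ≥ 2`.  Let `l₀ ∈ T_C` and let `P₁ ≠ P₂` be two points of `C₁ ∩ l₀`.  Then there is
a loop `γ : [0,1] → T_C` based at `l₀` and, for each point `P ∈ C ∩ l₀`, a continuous
path `ψ P : [0,1] → ℙ²` starting at `P` with `ψ P t ∈ C ∩ γ t` for all `t`, such that at
each time `t` the points `ψ P t`, `P ∈ C ∩ l₀`, are pairwise distinct, and the monodromy
at `t = 1` transposes `P₁` and `P₂` and fixes the remaining points of `C ∩ l₀`. -/
theorem exists_loop_transposing_two_points (F F₁ : MvPolynomial (Fin 3) ℂ) (d d₁ : ℕ)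
    (hd : 1 ≤ d) (hF : F.IsHomogeneous d) (hsq : Squarefree F)
    (hirr : Irreducible F₁) (hdvd : F₁ ∣ F) (hF₁ : F₁.IsHomogeneous d₁) (hd₁ : 2 ≤ d₁)
    (l₀ : P2) (hl₀ : l₀ ∈ transversalLines F d)
    (P₁ P₂ : P2) (hP₁ : P₁ ∈ curveSet F₁ ∩ lineSet l₀) (hP₂ : P₂ ∈ curveSet F₁ ∩ lineSet l₀)
    (hne : P₁ ≠ P₂) :
    ∃ γ : unitInterval → P2, Continuous γ ∧ (∀ t, γ t ∈ transversalLines F d) ∧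
      γ 0 = l₀ ∧ γ 1 = l₀ ∧
      ∃ ψ : P2 → unitInterval → P2,
        (∀ P ∈ curveSet F ∩ lineSet l₀, Continuous (ψ P) ∧ ψ P 0 = P ∧
          ∀ t, ψ P t ∈ curveSet F ∩ lineSet (γ t)) ∧
        (∀ t : unitInterval, ∀ P ∈ curveSet F ∩ lineSet l₀, ∀ Q ∈ curveSet F ∩ lineSet l₀,
          ψ P t = ψ Q t → P = Q) ∧
        ψ P₁ 1 = P₂ ∧ ψ P₂ 1 = P₁ ∧
        ∀ P ∈ curveSet F ∩ lineSet l₀, P ≠ P₁ → P ≠ P₂ → ψ P 1 = P := by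
  induction l₀ using Projectivization.ind with
  | h ξ hξ =>
  induction P₁ using Projectivization.ind with
  | h u hu =>
  induction P₂ using Projectivization.ind with
  | h p hp =>
  have hsub : ∀ z, eval z F₁ = 0 → eval z F = 0 := fun z hz => by
    obtain ⟨K, rfl⟩ := hdvd
    rw [map_mul, hz, zero_mul]
  have hu₁ := (mk_mem_curveSet_iff hF₁ hu).1 hP₁.1
  have hp₁ := (mk_mem_curveSet_iff hF₁ hp).1 hP₂.1
  have hξu := (mk_mem_lineSet_mk_iff hξ hu).1 hP₁.2
  have hξp := (mk_mem_lineSet_mk_iff hξ hp).1 hP₂.2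
  have hup : LinearIndependent ℂ ![u, p] := (LinearIndependent.pair_iff' hu).2 fun a ha =>
    hne ((Projectivization.mk_eq_mk_iff' ℂ _ _ _ _).2 ⟨a, ha⟩).symm
  obtain ⟨c, hc⟩ : ∃ c : ℂ, eval (u + c • p) F ≠ 0 := by
    by_contra! hall
    have hinf := Set.infinite_of_injective_forall_mem (linePoint_injective hup)
      (s := curveSet F ∩ lineSet (Projectivization.mk ℂ ξ hξ)) fun c =>
        ⟨(mk_mem_curveSet_iff hF _).2 (hall c), (mk_mem_lineSet_mk_iff hξ _).2 (by
          rw [dotProduct_add, dotProduct_smul, hξu, hξp, smul_zero, add_zero])⟩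
    have h0 : 0 = d := hinf.ncard.symm.trans hl₀
    omega
  have hc0 : c ≠ 0 := by
    rintro rfl
    exact hc (by rw [zero_smul, add_zero, hsub u hu₁])
  obtain ⟨v, hv⟩ : ∃ v, v = u + c • p := ⟨_, rfl⟩
  rw [← hv] at hc
  have hξv : ξ ⬝ᵥ v = 0 := by
    rw [hv, dotProduct_add, dotProduct_smul, hξu, hξp, smul_zero, add_zero]
  have hpv : u + (-1 : ℂ) • v = (-c) • p := by
    rw [hv]
    module
  have huv : LinearIndependent ℂ ![u, v] := LinearIndependent.pair_iff.2 fun s t hst => by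
    have h1 := LinearIndependent.pair_iff.1 hup (s + t) (t * c) (by
      rw [← hst, hv]
      module)
    have ht := (mul_eq_zero.1 h1.2).resolve_right hc0
    exact ⟨by simpa [ht] using h1.1, ht⟩
  have hP₁' : linePoint huv 0 = Projectivization.mk ℂ u hu :=
    (Projectivization.mk_eq_mk_iff' ℂ _ _ _ _).2 ⟨1, by simp⟩
  have hP₂' : linePoint huv (-1) = Projectivization.mk ℂ p hp :=
    (Projectivization.mk_eq_mk_iff' ℂ _ _ _ _).2 ⟨-c, hpv.symm⟩
  have hv₁ : eval (u + (-1 : ℂ) • v) F₁ = 0 := by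
    rw [hpv, eval_smul_of_isHomogeneous hF₁, hp₁, mul_zero]
  have hcard : {x | (pencil u v F).eval x = 0}.ncard = d := by
    simp only [eval_pencil]
    rw [← Set.ncard_image_of_injective _ (linePoint_injective huv),
      ← curveSet_inter_lineSet_mk huv hF hc hξ hξu hξv]
    exact hl₀
  obtain ⟨x, hx, hr⟩ := exists_injective_roots_of_ncard hd hcard
  have hroot : ∀ r, eval (u + r • v) F = 0 → ∃ k, x k = r := fun r h =>
    exists_eq_of_root (pencil_ne_zero hF hc) (natDegree_pencil hF hc).le hx hr
      ((eval_pencil ..).trans h)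
  obtain ⟨i, hi⟩ := hroot 0 (by rw [zero_smul, add_zero, hsub u hu₁])
  obtain ⟨j, hj⟩ := hroot (-1) (hsub _ hv₁)
  have hij : i ≠ j := by
    rintro rfl
    simp [hi] at hj
  have hrange := curveSet_inter_lineSet_eq_range huv hF hc hξ hξu hξv hx hr
  have hl : Projectivization.mk ℂ _ (crossProduct_ne_zero_iff_linearIndependent.2 huv) =
    Projectivization.mk ℂ ξ hξ := mk_crossProduct_eq huv hξ hξu hξv
  obtain ⟨b, hb0, hb1, hb2, hbs⟩ := exists_transversal_direction huv hd hF hc hx hr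
    (S := {x i, x j}) ⟨x i, by simp⟩
  subst hb0 hb1
  obtain ⟨γ, hγ, hγT, hγ0, hγ1, φ, hφ, hφinj, hφ0, hφ1⟩ := exists_loop_of_joinedIn b huv hF
    (joinedIn_rootConfigurations_pencil_swap b hd hF hirr hdvd hF₁ hd₁ hc hb2 hx hr hij
      (fun k hk => (hbs k hk).2) (by simpa [hi] using hu₁) (by rwa [hj]))
  have hκ : ∀ P, ∃ k, P ∈ curveSet F ∩ lineSet (Projectivization.mk ℂ ξ hξ) →
      linePoint huv (x k) = P := fun P => by
    by_cases hP : P ∈ curveSet F ∩ lineSet (Projectivization.mk ℂ ξ hξ)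
    · rw [hrange] at hP
      exact hP.imp fun k hk _ => hk
    · exact ⟨i, fun h => absurd h hP⟩
  choose κ hκ using hκ
  have hκ' : ∀ k, κ (linePoint huv (x k)) = k := fun k =>
    hx (linePoint_injective huv (hκ _ (hrange ▸ ⟨k, rfl⟩)))
  have hκ₁ : κ (Projectivization.mk ℂ (b 0) hu) = i := by rw [← hP₁', ← hi, hκ']
  have hκ₂ : κ (Projectivization.mk ℂ p hp) = j := by rw [← hP₂', ← hj, hκ']
  refine ⟨γ, hγ, hγT, hγ0.trans hl, hγ1.trans hl, fun P => φ (κ P),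
    fun P hP => ⟨(hφ _).1, (hφ0 _).trans (hκ P hP), (hφ _).2⟩, fun t P hP Q hQ h => ?_, ?_, ?_,
    fun P hP h1 h2 => ?_⟩
  · rw [← hκ P hP, ← hκ Q hQ, hφinj t h]
  · simp only [hκ₁, hφ1, Function.comp_apply, Equiv.swap_apply_left, hj, hP₂']
  · simp only [hκ₂, hφ1, Function.comp_apply, Equiv.swap_apply_right, hi, hP₁']
  · have h3 : κ P ≠ i := fun h => h1 (by rw [← hκ P hP, h, hi, hP₁'])
    have h4 : κ P ≠ j := fun h => h2 (by rw [← hκ P hP, h, hj, hP₂'])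
    simp only [hφ1, Function.comp_apply, Equiv.swap_apply_of_ne_of_ne h3 h4, hκ P hP]
end
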